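/- arXiv:2603.13984 — 4 statements merged into one kernel-verified Lean document; each statement's English description precedes it below -/
import Mathlib

section
/- Let p ≥ 5 be a prime, m ≥ 2, and let A be an element of Γ_1(m,p) with A^k = I for some k ∈ {1,2,3,4,6}. Then 1 is an eigenvalue of A, i.e. det(A − I) = 0. -/
open Matrix

/-- The row vector `(0,…,0,1)` in `(ZMod p)^m`. -/
def stdLast (m p : ℕ) : Fin m → ZMod p := fun j => if (j : ℕ) = m - 1 then 1 else 0

/-- The subgroup of `GL m (ZMod p)` fixing the row vector `(0,…,0,1)` (equivalently, whose
last row is `(0,…,0,1)`). -/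
def rowStab (m p : ℕ) : Subgroup (GL (Fin m) (ZMod p)) where
  carrier := {g | stdLast m p ᵥ* (g : Matrix (Fin m) (Fin m) (ZMod p)) = stdLast m p}
  one_mem' := by simp
  mul_mem' := by
    intro a b ha hb
    simp only [Set.mem_setOf_eq, Units.val_mul] at *
    rw [← Matrix.vecMul_vecMul, ha, hb]
  inv_mem' := by
    intro a ha
    simp only [Set.mem_setOf_eq] at *
    calc stdLast m p ᵥ* (↑a⁻¹ : Matrix (Fin m) (Fin m) (ZMod p))
        = (stdLast m p ᵥ* (a : Matrix (Fin m) (Fin m) (ZMod p))) ᵥ* (↑a⁻¹ : Matrix (Fin m) (Fin m) (ZMod p)) := by rw [ha]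
      _ = stdLast m p ᵥ* ((a : Matrix (Fin m) (Fin m) (ZMod p)) * (↑a⁻¹ : Matrix (Fin m) (Fin m) (ZMod p))) := Matrix.vecMul_vecMul _ _ _
      _ = stdLast m p := by
          rw [show (a : Matrix (Fin m) (Fin m) (ZMod p)) * (↑a⁻¹ : Matrix (Fin m) (Fin m) (ZMod p)) = 1 by
            rw [← Units.val_mul, mul_inv_cancel, Units.val_one]]
          simp

/-- `Γ₁(m,p)`: the subgroup of `GL m ℤ` of matrices fixing the vector `(0,…,0,1)` modulo `p`,
i.e. whose last row is congruent to `(0,…,0,1)` mod `p`. -/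
def Gamma1' (m p : ℕ) : Subgroup (GL (Fin m) ℤ) :=
  (rowStab m p).comap (Matrix.GeneralLinearGroup.map (Int.castRingHom (ZMod p)))

/-- If `p ≥ 5` is prime, `m ≥ 2`, and `A ∈ Γ₁(m,p)` satisfies `A^k = 1` for some
`k ∈ {1,2,3,4,6}`, then `1` is an eigenvalue of `A`, i.e. `det(A − I) = 0`. -/
theorem stmt2 (p m : ℕ) (hp : p.Prime) (hp5 : 5 ≤ p) (hm : 2 ≤ m)
    (A : GL (Fin m) ℤ) (hA : A ∈ Gamma1' m p)
    (htor : ∃ k ∈ ({1, 2, 3, 4, 6} : Set ℕ), A ^ k = 1) :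
    ((A : Matrix (Fin m) (Fin m) ℤ) - 1).det = 0 := by
  by_contra hdet
  obtain ⟨k, hk, hAk⟩ := htor
  have hAk' : (A : Matrix (Fin m) (Fin m) ℤ) ^ k = 1 := by
    rw [← Units.val_pow_eq_pow_val, hAk, Units.val_one]
  have hmul : ((A : Matrix (Fin m) (Fin m) ℤ) - 1) *
      (∑ i ∈ Finset.range k, (A : Matrix (Fin m) (Fin m) ℤ) ^ i) = 0 := by
    rw [mul_geom_sum, hAk', sub_self]
  have hN : (∑ i ∈ Finset.range k, (A : Matrix (Fin m) (Fin m) ℤ) ^ i) = 0 := by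
    have h := congrArg (fun M => ((A : Matrix (Fin m) (Fin m) ℤ) - 1).adjugate * M) hmul
    simp only [← Matrix.mul_assoc, Matrix.adjugate_mul, Matrix.mul_zero, Matrix.smul_mul,
      Matrix.one_mul] at h
    exact (smul_eq_zero.mp h).resolve_left hdet
  have hB : stdLast m p ᵥ* ((Int.castRingHom (ZMod p)).mapMatrix
      (A : Matrix (Fin m) (Fin m) ℤ)) = stdLast m p := hA
  have hNp := congrArg ((Int.castRingHom (ZMod p)).mapMatrix) hN
  rw [map_sum, map_zero] at hNp
  simp only [map_pow] at hNp
  generalize (Int.castRingHom (ZMod p)).mapMatrix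
      (A : Matrix (Fin m) (Fin m) ℤ) = B at hB hNp
  have hpow : ∀ i : ℕ, stdLast m p ᵥ* (B ^ i) = stdLast m p := by
    intro i
    induction i with
    | zero => simp
    | succ n ih => rw [pow_succ, ← Matrix.vecMul_vecMul, ih, hB]
  have hsum : ∀ n : ℕ, stdLast m p ᵥ* (∑ i ∈ Finset.range n, B ^ i) = n • stdLast m p := by
    intro n
    induction n with
    | zero => simp
    | succ n ih => rw [Finset.sum_range_succ, Matrix.vecMul_add, ih, hpow, succ_nsmul]
  have h := hsum k
  rw [hNp, Matrix.vecMul_zero] at h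
  have h1 := congrFun h ⟨m - 1, by omega⟩
  simp [stdLast] at h1
  have h2 : p ∣ k := (ZMod.natCast_eq_zero_iff k p).mp h1.symm
  simp only [Set.mem_insert_iff, Set.mem_singleton_iff] at hk
  rcases hk with rfl | rfl | rfl | rfl | rfl
  · exact absurd (Nat.le_of_dvd (by norm_num) h2) (by omega)
  · exact absurd (Nat.le_of_dvd (by norm_num) h2) (by omega)
  · exact absurd (Nat.le_of_dvd (by norm_num) h2) (by omega)
  · exact absurd (Nat.le_of_dvd (by norm_num) h2) (by omega)
  · have h3 : p ∣ 2 * 3 := h2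
    rcases (Nat.Prime.dvd_mul hp).mp h3 with h | h
    · exact absurd (Nat.le_of_dvd (by norm_num) h) (by omega)
    · exact absurd (Nat.le_of_dvd (by norm_num) h) (by omega)
end

section
/- Let p ≥ 5 be a prime, G = GL_2(ℤ), Γ = Γ_1(2,p), and let A ∈ Γ be a torsion element whose characteristic polynomial has 1 as a root of multiplicity exactly one (equivalently, A has eigenvalues 1 and −1). Set N_G^Γ(A) = {X ∈ G : X A X⁻¹ ∈ Γ} and let C_G(A) be the centralizer of A in G. Then the double coset space Γ\N_G^Γ(A)/C_G(A), i.e. the quotient of N_G^Γ(A) by the equivalence X ~ γXc (γ ∈ Γ, c ∈ C_G(A)), has exactly (p−1)/2 elements. -/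
open Matrix

/-- The double-coset setoid `Γ \ N_G^Γ(A) / C_G(A)` on `N_G^Γ(A) = {X : G | X A X⁻¹ ∈ Γ}`:
`X ~ Y` iff `Y = γ X c` with `γ ∈ Γ` and `c` in the centralizer of `A` in `G`. -/
def dosetSetoid {G : Type*} [Group G] (Γ : Subgroup G) (A : G) :
    Setoid {X : G // X * A * X⁻¹ ∈ Γ} where
  r X Y := ∃ γ ∈ Γ, ∃ c ∈ Subgroup.centralizer {A}, (Y : G) = γ * (X : G) * c
  iseqv := by
    constructor
    · intro X
      exact ⟨1, Γ.one_mem, 1, Subgroup.one_mem _, by group⟩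
    · rintro X Y ⟨γ, hγ, c, hc, h⟩
      refine ⟨γ⁻¹, Γ.inv_mem hγ, c⁻¹, Subgroup.inv_mem _ hc, ?_⟩
      rw [h]; group
    · rintro X Y Z ⟨γ, hγ, c, hc, h⟩ ⟨γ', hγ', c', hc', h'⟩
      refine ⟨γ' * γ, Γ.mul_mem hγ' hγ, c * c', Subgroup.mul_mem _ hc hc', ?_⟩
      rw [h', h]; group

lemma mem_gamma_iff (p : ℕ) (g : GL (Fin 2) ℤ) :
    g ∈ Gamma1' 2 p ↔ ((g 1 0 : ℤ) : ZMod p) = 0 ∧ ((g 1 1 : ℤ) : ZMod p) = 1 := by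
  have h : g ∈ Gamma1' 2 p ↔ stdLast 2 p ᵥ*
    ((Matrix.GeneralLinearGroup.map (Int.castRingHom (ZMod p)) g : GL (Fin 2) (ZMod p)) :
      Matrix (Fin 2) (Fin 2) (ZMod p)) = stdLast 2 p := Iff.rfl
  rw [h, funext_iff, Fin.forall_fin_two]
  simp [stdLast, Matrix.vecMul, dotProduct, Fin.sum_univ_two]

lemma gl_det (g : GL (Fin 2) ℤ) :
    g 0 0 * g 1 1 - g 0 1 * g 1 0 = 1 ∨ g 0 0 * g 1 1 - g 0 1 * g 1 0 = -1 := by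
  have h : IsUnit (g : Matrix (Fin 2) (Fin 2) ℤ).det := (Matrix.isUnit_iff_isUnit_det _).1 g.isUnit
  rw [Int.isUnit_iff, Matrix.det_fin_two] at h
  exact h

lemma gl_mul_apply (g h : GL (Fin 2) ℤ) (i j : Fin 2) :
    (g * h) i j = g i 0 * h 0 j + g i 1 * h 1 j := by
  simp [Matrix.mul_apply, Fin.sum_univ_two]

lemma cast_det (p : ℕ) (g : GL (Fin 2) ℤ) :
    ((g 0 0 : ℤ) : ZMod p) * (g 1 1 : ℤ) - (g 0 1 : ℤ) * (g 1 0 : ℤ) = 1 ∨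
    ((g 0 0 : ℤ) : ZMod p) * (g 1 1 : ℤ) - (g 0 1 : ℤ) * (g 1 0 : ℤ) = -1 := by
  rcases gl_det g with h | h
  · left; exact_mod_cast congrArg (Int.cast : ℤ → ZMod p) h
  · right; exact_mod_cast congrArg (Int.cast : ℤ → ZMod p) h

lemma diag_ne (p : ℕ) [Fact p.Prime] (g : GL (Fin 2) ℤ) (h : ((g 1 0 : ℤ) : ZMod p) = 0) :
    ((g 0 0 : ℤ) : ZMod p) ≠ 0 ∧ ((g 1 1 : ℤ) : ZMod p) ≠ 0 := by
  have := cast_det p g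
  constructor <;> intro h0 <;> simp [h, h0] at this

/-- The key criterion: if `B X = Z` and last rows of `X`, `Z` agree and are `(0,d)`, `B ∈ Γ`. -/
lemma mem_of_mul (p : ℕ) [Fact p.Prime] (B X Z : GL (Fin 2) ℤ) (h : B * X = Z)
    (hX : ((X 1 0 : ℤ) : ZMod p) = 0) (hZ : ((Z 1 0 : ℤ) : ZMod p) = 0)
    (hZX : ((Z 1 1 : ℤ) : ZMod p) = (X 1 1 : ℤ)) : B ∈ Gamma1' 2 p := by
  obtain ⟨h0, h1⟩ := diag_ne p X hX
  rw [mem_gamma_iff]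
  have e0 := gl_mul_apply B X 1 0
  have e1 := gl_mul_apply B X 1 1
  rw [h] at e0 e1
  rw [e0] at hZ
  rw [e1] at hZX
  push_cast at hZ hZX
  rw [hX, mul_zero, add_zero] at hZ
  have hb : ((B 1 0 : ℤ) : ZMod p) = 0 := (mul_eq_zero.1 hZ).resolve_right h0
  refine ⟨hb, ?_⟩
  rw [hb, zero_mul, zero_add] at hZX
  exact mul_right_cancel₀ h1 (by rw [hZX, one_mul])

lemma trace_det (A : GL (Fin 2) ℤ) (hmult : Polynomial.rootMultiplicity 1
      (Matrix.charpoly (A : Matrix (Fin 2) (Fin 2) ℤ)) = 1) :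
    A 0 0 + A 1 1 = 0 ∧ A 0 0 * A 1 1 - A 0 1 * A 1 0 = -1 := by
  have hroot : (Matrix.charpoly (A : Matrix (Fin 2) (Fin 2) ℤ)).IsRoot 1 := by
    apply (Polynomial.rootMultiplicity_pos (Matrix.charpoly_monic _).ne_zero).1
    omega
  have hc := Matrix.charpoly_fin_two (A : Matrix (Fin 2) (Fin 2) ℤ)
  have hr := hroot
  rw [hc] at hr
  simp [Polynomial.IsRoot, Matrix.trace_fin_two, Matrix.det_fin_two] at hr
  rcases gl_det A with h | h
  · exfalso
    have ht : A 0 0 + A 1 1 = 2 := by linarith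
    have : (Matrix.charpoly (A : Matrix (Fin 2) (Fin 2) ℤ)) =
        (Polynomial.X - Polynomial.C 1) ^ 2 := by
      rw [hc, Matrix.trace_fin_two, Matrix.det_fin_two, h, ht]
      simp only [map_one, map_ofNat]
      ring
    rw [this, Polynomial.rootMultiplicity_X_sub_C_pow] at hmult
    omega
  · exact ⟨by linarith, h⟩

/-- Elements of the centralizer have lower right entry `±1` mod `p`. -/
lemma centralizer_entry (p : ℕ) [Fact p.Prime] (hp5 : 5 ≤ p) (A c : GL (Fin 2) ℤ)
    (hA : A ∈ Gamma1' 2 p) (htr : A 0 0 + A 1 1 = 0)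
    (hdet : A 0 0 * A 1 1 - A 0 1 * A 1 0 = -1) (hc : A * c = c * A) :
    ((c 1 0 : ℤ) : ZMod p) = 0 ∧
      (((c 1 1 : ℤ) : ZMod p) = 1 ∨ ((c 1 1 : ℤ) : ZMod p) = -1) := by
  have h2 : (2 : ZMod p) ≠ 0 := by
    intro h
    have : ((2 : ℕ) : ZMod p) = 0 := by exact_mod_cast h
    rw [ZMod.natCast_eq_zero_iff] at this
    have := Nat.le_of_dvd (by norm_num) this
    omega
  have e00 : (A * c) 0 0 = (c * A) 0 0 := by rw [hc]
  have e01 : (A * c) 0 1 = (c * A) 0 1 := by rw [hc]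
  have e10 : (A * c) 1 0 = (c * A) 1 0 := by rw [hc]
  rw [gl_mul_apply, gl_mul_apply] at e00 e01 e10
  have hd := gl_det c
  rw [mem_gamma_iff] at hA
  obtain ⟨hA0, hA1⟩ := hA
  generalize A 0 0 = a at *
  generalize A 0 1 = b at *
  generalize A 1 0 = e at *
  generalize A 1 1 = f at *
  generalize c 0 0 = x at *
  generalize c 0 1 = y at *
  generalize c 1 0 = z at *
  generalize c 1 1 = t at *
  obtain rfl : f = -a := by linarith
  push_cast at hA1
  have ha : (a : ZMod p) = -1 := by rw [← hA1, neg_neg]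
  have hz : (z : ZMod p) = 0 := by
    have := congrArg (Int.cast : ℤ → ZMod p) e10
    push_cast at this
    rw [hA0, ha] at this
    have h3 : (2 : ZMod p) * z = 0 := by linear_combination this
    exact (mul_eq_zero.1 h3).resolve_left h2
  refine ⟨hz, ?_⟩
  obtain ⟨s, hs⟩ : ∃ s, s = a * x + b * z + e * y - a * t := ⟨_, rfl⟩
  have hcast : (s : ZMod p) = t - x := by
    rw [hs]; push_cast; rw [ha, hA0, hz]; ring
  have key : s ^ 2 = (x + t) ^ 2 - 4 * (x * t - y * z) := by
    have hbe : b * e = 1 - a ^ 2 := by linarith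
    have k1 : s * a = x - t := by
      rw [hs]; linear_combination (x - t) * hbe + a * e00 + e * e01
    have k2 : s * b = 2 * y := by
      rw [hs]; linear_combination 2 * y * hbe + b * e00 - a * e01
    have k3 : s * e = 2 * z := by
      rw [hs]; linear_combination 2 * z * hbe - e * e00 + a * e10
    linear_combination (-s ^ 2) * hbe + (s * a + x - t) * k1 + s * e * k2 + 2 * y * k3
  have hpar : Even (x + t + s) := by
    have h1 : Even ((x + t) ^ 2 - s ^ 2) := ⟨2 * (x * t - y * z), by rw [key]; ring⟩
    rw [Int.even_sub, Int.even_pow' two_ne_zero, Int.even_pow' two_ne_zero] at h1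
    exact Int.even_add.2 h1
  obtain ⟨l, hl⟩ := hpar
  have hlm : l * (x + t - l) = x * t - y * z := by
    have hs' : s = 2 * l - x - t := by linarith
    rw [hs'] at key
    linarith
  have hlu : IsUnit l := by
    apply isUnit_of_dvd_unit (Dvd.intro _ hlm)
    rw [Int.isUnit_iff]
    rcases hd with h | h
    · left; linarith
    · right; linarith
  have hlt : (l : ZMod p) = t := by
    have := congrArg (Int.cast : ℤ → ZMod p) hl
    push_cast at this
    rw [hcast] at this
    apply mul_left_cancel₀ h2
    linear_combination -this
  rw [← hlt]
  rcases Int.isUnit_iff.1 hlu with h | h <;> simp [h]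

/-- For a prime `p ≥ 5` and a torsion element `A` of `Γ₁(2,p)` whose characteristic polynomial
has `1` as a root of multiplicity exactly one, the double coset space
`Γ₁(2,p) \ N_G^Γ(A) / C_G(A)` (with `G = GL 2 ℤ`) has exactly `(p−1)/2` elements. -/
theorem stmt3 (p : ℕ) (hp : p.Prime) (hp5 : 5 ≤ p)
    (A : GL (Fin 2) ℤ) (hA : A ∈ Gamma1' 2 p)
    (htor : ∃ k : ℕ, 0 < k ∧ A ^ k = 1)
    (hmult : Polynomial.rootMultiplicity 1
      (Matrix.charpoly (A : Matrix (Fin 2) (Fin 2) ℤ)) = 1) :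
    Nat.card (Quotient (dosetSetoid (Gamma1' 2 p) A)) = (p - 1) / 2 := by
  have : Fact p.Prime := ⟨hp⟩
  obtain ⟨htr, hdet⟩ := trace_det A hmult
  have h2 : (2 : ZMod p) ≠ 0 := by
    intro h
    have : ((2 : ℕ) : ZMod p) = 0 := by exact_mod_cast h
    rw [ZMod.natCast_eq_zero_iff] at this
    have := Nat.le_of_dvd (by norm_num) this
    omega
  have hA' := (mem_gamma_iff p A).1 hA
  have hA00 : ((A 0 0 : ℤ) : ZMod p) = -1 := by
    have : A 0 0 = - A 1 1 := by linarith
    rw [this]; push_cast; rw [hA'.2]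
  have hN : ∀ X : GL (Fin 2) ℤ, X * A * X⁻¹ ∈ Gamma1' 2 p ↔ ((X 1 0 : ℤ) : ZMod p) = 0 := by
    intro X
    have r0 := gl_mul_apply X A 1 0
    have r1 := gl_mul_apply X A 1 1
    constructor
    · intro h
      rw [mem_gamma_iff] at h
      have e : X * A * X⁻¹ * X = X * A := by group
      have e0 := gl_mul_apply (X * A * X⁻¹) X 1 0
      rw [e, r0] at e0
      have := congrArg (Int.cast : ℤ → ZMod p) e0
      simp only [Int.cast_add, Int.cast_mul] at this
      rw [h.1, h.2, hA'.1, hA00] at this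
      have h3 : (2 : ZMod p) * (X 1 0 : ℤ) = 0 := by linear_combination -this
      exact (mul_eq_zero.1 h3).resolve_left h2
    · intro h
      apply mem_of_mul p _ X (X * A) (by group) h
      · rw [r0]; push_cast; rw [h, hA'.1]; ring
      · rw [r1]; push_cast; rw [h, hA'.2]; ring
  let f : {X : GL (Fin 2) ℤ // X * A * X⁻¹ ∈ Gamma1' 2 p} → (ZMod p)ˣ := fun X =>
    Units.mk0 ((X.1 1 1 : ℤ) : ZMod p) (diag_ne p X.1 ((hN X.1).1 X.2)).2
  have hfv : ∀ X, ((f X : (ZMod p)ˣ) : ZMod p) = ((X.1 1 1 : ℤ) : ZMod p) := fun X => rfl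
  let H : Subgroup (ZMod p)ˣ := Subgroup.zpowers (-1)
  have hH : ∀ u : (ZMod p)ˣ, u ∈ H ↔ u = 1 ∨ u = -1 := by
    intro u
    constructor
    · rintro ⟨k, rfl⟩
      rcases Int.even_or_odd k with hk | hk
      · left; exact hk.neg_one_zpow
      · right; exact hk.neg_one_zpow
    · rintro (rfl | rfl)
      · exact H.one_mem
      · exact Subgroup.mem_zpowers _
  have hrel : ∀ X Y, (dosetSetoid (Gamma1' 2 p) A).r X Y ↔
      (QuotientGroup.mk (f X) : (ZMod p)ˣ ⧸ H) = QuotientGroup.mk (f Y) := by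
    intro X Y
    have hX := (hN X.1).1 X.2
    have hY := (hN Y.1).1 Y.2
    rw [QuotientGroup.eq, hH]
    have hXY : ((f X)⁻¹ * f Y = 1 ∨ (f X)⁻¹ * f Y = -1) ↔
        (((Y.1 1 1 : ℤ) : ZMod p) = (X.1 1 1 : ℤ) ∨ ((Y.1 1 1 : ℤ) : ZMod p) = -(X.1 1 1 : ℤ)) := by
      rw [inv_mul_eq_iff_eq_mul, inv_mul_eq_iff_eq_mul, Units.ext_iff, Units.ext_iff]
      simp [hfv]
    rw [hXY]
    constructor
    · rintro ⟨γ, hγ, c, hc, h⟩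
      rw [mem_gamma_iff] at hγ
      rw [Subgroup.mem_centralizer_singleton_iff] at hc
      have hce := centralizer_entry p hp5 A c hA htr hdet (by first | exact hc | exact hc.symm)
      have e1 := gl_mul_apply (γ * X.1) c 1 1
      rw [← h, gl_mul_apply, gl_mul_apply] at e1
      rw [e1]
      push_cast
      rw [hγ.1, hγ.2, hX]
      rcases hce.2 with h | h <;> rw [h] <;> simp
    · rintro (h | h)
      · exact ⟨Y.1 * X.1⁻¹, mem_of_mul p _ X.1 Y.1 (by group) hX hY h, 1, Subgroup.one_mem _,
          by group⟩
      · refine ⟨-Y.1 * X.1⁻¹, mem_of_mul p _ X.1 (-Y.1) (by group) hX ?_ ?_, -1, ?_, ?_⟩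
        · simp [hY]
        · simp [h]
        · rw [Subgroup.mem_centralizer_singleton_iff]; simp
        · simp
  have hbij : Function.Bijective (Quotient.lift (s := dosetSetoid (Gamma1' 2 p) A)
      (fun X => (QuotientGroup.mk (f X) : (ZMod p)ˣ ⧸ H)) (fun X Y h => (hrel X Y).1 h)) := by
    constructor
    · intro a b
      induction a using Quotient.inductionOn
      induction b using Quotient.inductionOn
      intro h
      exact Quotient.sound ((hrel _ _).2 h)
    · intro q
      obtain ⟨u, rfl⟩ := QuotientGroup.mk_surjective q
      have hcop : Nat.Coprime (u : ZMod p).val p := ZMod.val_coe_unit_coprime u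
      have hic : IsCoprime (((u : ZMod p).val : ℕ) : ℤ) (p : ℤ) := Nat.isCoprime_iff_coprime.2 hcop
      obtain ⟨r, s, hrs⟩ := hic
      let M : Matrix (Fin 2) (Fin 2) ℤ := !![r, -s; (p : ℤ), (((u : ZMod p).val : ℕ) : ℤ)]
      have hM : M.det = 1 := by
        simp only [M, Matrix.det_fin_two_of]; linarith
      let X : GL (Fin 2) ℤ := Matrix.GeneralLinearGroup.mk'' M (by rw [hM]; exact isUnit_one)
      have hX10 : X 1 0 = (p : ℤ) := rfl
      have hX11 : X 1 1 = (((u : ZMod p).val : ℕ) : ℤ) := rfl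
      refine ⟨Quotient.mk _ ⟨X, (hN X).2 (by rw [hX10]; simp)⟩, ?_⟩
      simp only [Quotient.lift_mk]
      congr 1
      ext
      rw [hfv]
      simp only [hX11]
      simp
  rw [Nat.card_congr (Equiv.ofBijective _ hbij)]
  have hcard := Subgroup.card_eq_card_quotient_mul_card_subgroup H
  have hHc : Nat.card H = 2 := by
    rw [Nat.card_zpowers, ← orderOf_units, Units.val_neg, Units.val_one, orderOf_neg_one,
      ZMod.ringChar_zmod_n, if_neg (by omega)]
  rw [hHc, Nat.card_eq_fintype_card, ZMod.card_units] at hcard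
  omega
end

section
/- Let p ≥ 5 be a prime, m ≥ 2, G = GL_m(ℤ), Γ = Γ_1(m,p), and let A ∈ Γ satisfy A^12 = I and have 1 as a root of its characteristic polynomial of multiplicity exactly one. Set N_G^Γ(A) = {X ∈ G : X A X⁻¹ ∈ Γ} and let C_G(A) be the centralizer of A in G. Then the double coset space Γ\N_G^Γ(A)/C_G(A), i.e. the quotient of N_G^Γ(A) by the equivalence X ~ γXc (γ ∈ Γ, c ∈ C_G(A)), has exactly (p−1)/2 elements. -/
open Matrix

/-- The norm element `1 + A + ... + A^11`. -/
def normSum {R : Type*} [CommRing R] {m : ℕ} (A : Matrix (Fin m) (Fin m) R) :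
    Matrix (Fin m) (Fin m) R := ∑ i ∈ Finset.range 12, A ^ i

lemma vecMul_pow_fixed {R : Type*} [CommRing R] {m : ℕ} (A : Matrix (Fin m) (Fin m) R)
    (v : Fin m → R) (h : v ᵥ* A = v) (k : ℕ) : v ᵥ* A ^ k = v := by
  induction k with
  | zero => simp
  | succ k ih => rw [pow_succ, ← Matrix.vecMul_vecMul, ih, h]

lemma vecMul_normSum {R : Type*} [CommRing R] {m : ℕ} (A : Matrix (Fin m) (Fin m) R)
    (v : Fin m → R) (h : v ᵥ* A = v) : v ᵥ* normSum A = (12 : R) • v := by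
  unfold normSum
  rw [Matrix.vecMul_sum]
  simp only [vecMul_pow_fixed A v h]
  ext j
  simp

lemma normSum_comm {R : Type*} [CommRing R] {m : ℕ} (A : Matrix (Fin m) (Fin m) R) :
    A * normSum A = normSum A * A := by
  unfold normSum
  rw [Finset.mul_sum, Finset.sum_mul]
  refine Finset.sum_congr rfl fun i _ => ?_
  rw [← pow_succ, ← pow_succ']

lemma normSum_mul {R : Type*} [CommRing R] {m : ℕ} (A : Matrix (Fin m) (Fin m) R)
    (h : A ^ 12 = 1) : normSum A * A = normSum A := by
  have := geom_sum_mul A 12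
  rw [h, sub_self, mul_sub, mul_one, sub_eq_zero] at this
  exact this

lemma normSum_map {R S : Type*} [CommRing R] [CommRing S] {m : ℕ} (f : R →+* S)
    (A : Matrix (Fin m) (Fin m) R) : normSum (f.mapMatrix A) = f.mapMatrix (normSum A) := by
  unfold normSum
  simp only [map_sum, map_pow]

lemma normSum_minors {m : ℕ} (A : Matrix (Fin m) (Fin m) ℤ) (h : A ^ 12 = 1)
    (hmult : Polynomial.rootMultiplicity 1 A.charpoly = 1) (i j k l : Fin m) :
    normSum A i j * normSum A k l = normSum A i l * normSum A k j := by
  set f := Int.castRingHom ℚ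
  set B := f.mapMatrix A with hB
  have hB12 : B ^ 12 = 1 := by rw [hB, ← map_pow, h, map_one]
  have hm1 : Polynomial.rootMultiplicity 1 B.charpoly = 1 := by
    rw [Polynomial.eq_rootMultiplicity_map (f := f) Int.cast_injective,
      ← Matrix.charpoly_map] at hmult
    rw [map_one] at hmult
    exact hmult
  have hfin : Module.finrank ℚ (Module.End.eigenspace (Matrix.toLin' B) 1) ≤ 1 := by
    refine (LinearMap.finrank_eigenspace_le _ _).trans ?_
    rw [Matrix.charpoly_toLin', hm1]
  obtain ⟨v, hv⟩ := finrank_le_one_iff.mp hfin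
  have hcol : ∀ j, ∃ c : ℚ, ∀ i, normSum B i j = c * v.1 i := by
    intro j
    have hmem : (normSum B).col j ∈ Module.End.eigenspace (Matrix.toLin' B) 1 := by
      rw [Module.End.mem_eigenspace_iff, Matrix.toLin'_apply, one_smul]
      have h1 : B * normSum B = normSum B := by rw [normSum_comm, normSum_mul _ hB12]
      ext i
      conv_rhs => rw [← h1]
      rfl
    obtain ⟨c, hc⟩ := hv ⟨_, hmem⟩
    refine ⟨c, fun i => ?_⟩
    have := congrFun (congrArg Subtype.val hc) i
    simpa using this.symm
  obtain ⟨a, ha⟩ := hcol j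
  obtain ⟨b, hb⟩ := hcol l
  have key : normSum B i j * normSum B k l = normSum B i l * normSum B k j := by
    rw [ha, ha, hb, hb]; ring
  rw [hB, normSum_map] at key
  simp only [RingHom.mapMatrix_apply, Matrix.map_apply, f, eq_intCast] at key
  exact_mod_cast key

lemma fixed_prop {R : Type*} [CommRing R] [IsDomain R] {m : ℕ} (f : ℤ →+* R)
    (h12 : (12 : R) ≠ 0)
    (A : Matrix (Fin m) (Fin m) ℤ)
    (hS : ∀ i j k l, normSum A i j * normSum A k l = normSum A i l * normSum A k j)
    (v w : Fin m → R) (hv : v ᵥ* f.mapMatrix A = v) (hw : w ᵥ* f.mapMatrix A = w) (j l : Fin m) :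
    v j * w l = v l * w j := by
  have hv' := vecMul_normSum _ v hv
  have hw' := vecMul_normSum _ w hw
  rw [normSum_map] at hv' hw'
  have hvj : ∀ j, 12 * v j = ∑ i, v i * f (normSum A i j) := fun j => by
    have := congrFun hv' j
    simpa [Matrix.vecMul, dotProduct] using this.symm
  have hwj : ∀ j, 12 * w j = ∑ i, w i * f (normSum A i j) := fun j => by
    have := congrFun hw' j
    simpa [Matrix.vecMul, dotProduct] using this.symm
  have key : (12 * v j) * (12 * w l) = (12 * v l) * (12 * w j) := by
    rw [hvj, hvj, hwj, hwj, Finset.sum_mul_sum, Finset.sum_mul_sum]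
    refine Finset.sum_congr rfl fun i _ => Finset.sum_congr rfl fun k _ => ?_
    have := congrArg f (hS i j k l)
    rw [map_mul, map_mul] at this
    linear_combination (v i * w k) * this
  have h144 : (12 * 12 : R) ≠ 0 := mul_ne_zero h12 h12
  apply mul_left_cancel₀ h144
  linear_combination key

lemma prim_mult {m : ℕ} (g h : Fin m → ℤ) (hg : Finset.univ.gcd g = 1)
    (hgh : ∀ j l, h j * g l = h l * g j) : ∃ t : ℤ, h = t • g := by
  have hne : ∃ l, g l ≠ 0 := by
    by_contra! hcon
    have : Finset.univ.gcd g = 0 := Finset.gcd_eq_zero_iff.2 fun x _ => hcon x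
    omega
  obtain ⟨l, hl⟩ := hne
  have hd : g l ∣ h l := by
    have h1 : g l ∣ Finset.univ.gcd fun j => h l * g j :=
      Finset.dvd_gcd fun j _ => ⟨h j, by rw [← hgh]; ring⟩
    rw [Finset.gcd_mul_left, hg, mul_one] at h1
    exact dvd_normalize_iff.1 h1
  obtain ⟨t, ht⟩ := hd
  refine ⟨t, funext fun j => ?_⟩
  apply mul_right_cancel₀ hl
  rw [hgh, ht]
  simp only [Pi.smul_apply, smul_eq_mul]
  ring

lemma exists_prim {m : ℕ} (A : Matrix (Fin m) (Fin m) ℤ) (h : A ^ 12 = 1)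
    (hS : normSum A ≠ 0) : ∃ g : Fin m → ℤ, Finset.univ.gcd g = 1 ∧ g ᵥ* A = g := by
  have : ∃ i j, normSum A i j ≠ 0 := by
    by_contra! hcon
    exact hS (by ext i j; exact hcon i j)
  obtain ⟨i, j, hij⟩ := this
  obtain ⟨g, hg, hg1⟩ := Finset.extract_gcd (s := Finset.univ) (normSum A i) ⟨j, Finset.mem_univ _⟩
  set d := Finset.univ.gcd (normSum A i)
  have hd : d ≠ 0 := by
    intro h0
    exact hij (by rw [hg j (Finset.mem_univ _), h0, zero_mul])
  refine ⟨g, hg1, ?_⟩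
  have h1 : normSum A i = d • g := funext fun j => hg j (Finset.mem_univ _)
  have h2 : normSum A i ᵥ* A = normSum A i := by
    have := congrFun (normSum_mul A h) i
    rw [Matrix.mul_apply_eq_vecMul] at this
    exact this
  rw [h1, Matrix.smul_vecMul] at h2
  exact smul_right_injective _ hd h2

lemma exists_lift {m p : ℕ} (hm : 2 ≤ m) (a : ℤ) (ha : IsCoprime a (p : ℤ)) :
    ∃ X : GL (Fin m) ℤ, stdLast m p ᵥ*
      (Matrix.GeneralLinearGroup.map (Int.castRingHom (ZMod p)) X).val
        = (a : ZMod p) • stdLast m p := by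
  obtain ⟨n, rfl⟩ : ∃ n, m = n + 2 := ⟨m - 2, by omega⟩
  obtain ⟨x, y, hxy⟩ := ha
  set M : Matrix (Fin 2) (Fin 2) ℤ := !![x, -y; (p : ℤ), a]
  set Z : Matrix (Fin n ⊕ Fin 2) (Fin n ⊕ Fin 2) ℤ := Matrix.fromBlocks 1 0 0 M
  set X : Matrix (Fin (n+2)) (Fin (n+2)) ℤ := Matrix.reindex finSumFinEquiv finSumFinEquiv Z with hX
  have hdet : X.det = 1 := by
    rw [hX, Matrix.det_reindex_self, Matrix.det_fromBlocks_zero₂₁, Matrix.det_one, one_mul,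
      Matrix.det_fin_two_of]
    linarith
  refine ⟨Matrix.GeneralLinearGroup.mk'' X (by rw [hdet]; exact isUnit_one), ?_⟩
  have hs : stdLast (n+2) p = Pi.single (finSumFinEquiv (Sum.inr 1)) 1 := by
    ext j
    simp only [stdLast, Pi.single_apply, Fin.ext_iff, finSumFinEquiv_apply_right, Fin.val_natAdd]
    simp
  rw [hs, Matrix.single_one_vecMul]
  ext j
  obtain ⟨j, rfl⟩ := finSumFinEquiv.surjective j
  change ((X (finSumFinEquiv (Sum.inr 1)) (finSumFinEquiv j) : ℤ) : ZMod p) = _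
  rw [hX]
  simp only [Matrix.reindex_apply, Matrix.submatrix_apply, Equiv.symm_apply_apply]
  rcases j with j | j
  · simp [Z, Pi.single_apply, Fin.ext_iff]
    omega
  · fin_cases j <;> simp [Z, M, Pi.single_apply]

/-- For a prime `p ≥ 5`, `m ≥ 2`, and `A ∈ Γ₁(m,p)` with `A^12 = 1` whose characteristic
polynomial has `1` as a root of multiplicity exactly one, the double coset space
`Γ₁(m,p) \ N_G^Γ(A) / C_G(A)` (with `G = GL m ℤ`) has exactly `(p−1)/2` elements. -/
theorem stmt4 (p m : ℕ) (hp : p.Prime) (hp5 : 5 ≤ p) (hm : 2 ≤ m)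
    (A : GL (Fin m) ℤ) (hA : A ∈ Gamma1' m p)
    (htor : A ^ 12 = 1)
    (hmult : Polynomial.rootMultiplicity 1
      (Matrix.charpoly (A : Matrix (Fin m) (Fin m) ℤ)) = 1) :
    Nat.card (Quotient (dosetSetoid (Gamma1' m p) A)) = (p - 1) / 2 := by
  haveI : Fact p.Prime := ⟨hp⟩
  set f := Int.castRingHom (ZMod p) with hf
  set φ := Matrix.GeneralLinearGroup.map (n := Fin m) f with hφ
  set e := stdLast m p with he
  set A' : Matrix (Fin m) (Fin m) ℤ := A.val with hA'
  have hA12 : A' ^ 12 = 1 := by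
    have := congrArg Units.val htor
    simpa using this
  have memΓ : ∀ X : GL (Fin m) ℤ, X ∈ Gamma1' m p ↔ e ᵥ* (φ X).val = e := fun X => Iff.rfl
  have h12 : (12 : ZMod p) ≠ 0 := by
    intro h
    have h1 : ((12 : ℕ) : ZMod p) = 0 := by exact_mod_cast h
    rw [ZMod.natCast_eq_zero_iff] at h1
    have h2 : p ∣ 2 * 2 * 3 := h1
    rcases (Nat.Prime.dvd_mul hp).1 h2 with h3 | h3
    · rcases (Nat.Prime.dvd_mul hp).1 h3 with h3 | h3 <;> have := Nat.le_of_dvd (by norm_num) h3 <;> omega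
    · have := Nat.le_of_dvd (by norm_num) h3; omega
  have hmin := normSum_minors A' hA12 hmult
  set L : Fin m := ⟨m - 1, by omega⟩ with hL
  have heL : e L = 1 := by simp [he, stdLast, hL]
  have heA : e ᵥ* f.mapMatrix A' = e := hA
  have hprop : ∀ v : Fin m → ZMod p, v ᵥ* f.mapMatrix A' = v → v = v L • e := by
    intro v hv
    ext j
    have := fixed_prop f h12 A' hmin v e hv heA j L
    rw [heL, mul_one] at this
    exact this
  -- an integral primitive fixed vector
  have hS0 : normSum A' ≠ 0 := by
    intro h0
    have h1 := vecMul_normSum _ e heA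
    rw [normSum_map, h0, map_zero, Matrix.vecMul_zero] at h1
    have h2 := congrFun h1 L
    simp only [Pi.zero_apply, Pi.smul_apply, heL, smul_eq_mul, mul_one] at h2
    exact h12 h2.symm
  obtain ⟨g, hg1, hgA⟩ := exists_prim A' hA12 hS0
  have hcent : ∀ c ∈ Subgroup.centralizer {A}, ∃ t : ℤ, g ᵥ* c.val = t • g := by
    intro c hc
    have hcA : A' * c.val = c.val * A' := by
      have := Subgroup.mem_centralizer_iff.1 hc A rfl
      exact congrArg Units.val this
    apply prim_mult g _ hg1
    apply fixed_prop (RingHom.id ℤ) (by norm_num) A' hmin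
    · simp only [RingHom.mapMatrix_apply, RingHom.coe_id, Matrix.map_id]
      rw [Matrix.vecMul_vecMul, ← hcA, ← Matrix.vecMul_vecMul, hgA]
    · simpa using hgA
  have hgne : ∃ l, g l ≠ 0 := by
    by_contra! hcon
    have : Finset.univ.gcd g = 0 := Finset.gcd_eq_zero_iff.2 fun x _ => hcon x
    omega
  obtain ⟨l, hl⟩ := hgne
  have hsign : ∀ c ∈ Subgroup.centralizer {A}, e ᵥ* (φ c).val = e ∨ e ᵥ* (φ c).val = -e := by
    intro c hc
    obtain ⟨t, ht⟩ := hcent c hc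
    obtain ⟨s, hs⟩ := hcent c⁻¹ (Subgroup.inv_mem _ hc)
    have hts : t * s = 1 := by
      have h1 : (g ᵥ* c.val) ᵥ* (c⁻¹).val = g := by
        rw [Matrix.vecMul_vecMul, ← Units.val_mul, mul_inv_cancel, Units.val_one, Matrix.vecMul_one]
      rw [ht, Matrix.smul_vecMul, hs, smul_smul] at h1
      have h2 := congrFun h1 l
      simp only [Pi.smul_apply, smul_eq_mul] at h2
      apply mul_right_cancel₀ hl
      rw [h2, one_mul]
    have hbar : (f ∘ g) ᵥ* f.mapMatrix A' = f ∘ g := by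
      ext j
      have := congrArg f (congrFun hgA j)
      rw [RingHom.map_vecMul] at this
      exact this
    have hbar' := hprop _ hbar
    have hb0 : (f ∘ g) L ≠ 0 := by
      intro h0
      rw [h0, zero_smul] at hbar'
      have : (p : ℤ) ∣ Finset.univ.gcd g := Finset.dvd_gcd fun j _ => by
        have := congrFun hbar' j
        exact (ZMod.intCast_zmod_eq_zero_iff_dvd _ _).1 this
      rw [hg1] at this
      have := Int.le_of_dvd (by norm_num) this
      omega
    have hc1 : (f ∘ g) ᵥ* (φ c).val = (t : ZMod p) • (f ∘ g) := by
      ext j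
      have := congrArg f (congrFun ht j)
      rw [RingHom.map_vecMul] at this
      refine Eq.trans this ?_
      simp [f]
    rw [hbar', Matrix.smul_vecMul, smul_comm] at hc1
    have hc2 := smul_right_injective _ hb0 hc1
    rcases Int.eq_one_or_neg_one_of_mul_eq_one hts with h | h
    · left; rw [hc2, h]; simp
    · right; rw [hc2, h]; simp
  -- the invariant
  have hrow : ∀ X : {X : GL (Fin m) ℤ // X * A * X⁻¹ ∈ Gamma1' m p},
      ∃ u : (ZMod p)ˣ, e ᵥ* (φ X.1).val = (u : ZMod p) • e := by
    intro X
    have h1 := (memΓ _).1 X.2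
    have h2 : (e ᵥ* (φ X.1).val) ᵥ* f.mapMatrix A' = e ᵥ* (φ X.1).val := by
      conv_rhs => rw [← h1]
      change (e ᵥ* (φ X.1).val) ᵥ* (φ A).val = _
      rw [Matrix.vecMul_vecMul, Matrix.vecMul_vecMul, ← Units.val_mul, ← Units.val_mul, ← map_mul,
        ← map_mul, inv_mul_cancel_right]
    have h3 := hprop _ h2
    have h4 : (e ᵥ* (φ X.1).val) L ≠ 0 := by
      intro h0
      rw [h0, zero_smul] at h3
      have h5 : (e ᵥ* (φ X.1).val) ᵥ* ((φ X.1)⁻¹).val = e := by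
        rw [Matrix.vecMul_vecMul, ← Units.val_mul, mul_inv_cancel, Units.val_one, Matrix.vecMul_one]
      rw [h3, Matrix.zero_vecMul] at h5
      have := congrFun h5 L
      rw [heL] at this
      exact zero_ne_one this
    exact ⟨Units.mk0 _ h4, h3⟩
  choose lam hlam using hrow
  have heinj : ∀ a b : ZMod p, a • e = b • e → a = b := by
    intro a b h
    have := congrFun h L
    simpa [heL] using this
  set H : Subgroup (ZMod p)ˣ := Subgroup.zpowers (-1) with hH
  have hHmem : ∀ u : (ZMod p)ˣ, u ∈ H ↔ u = 1 ∨ u = -1 := by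
    intro u
    constructor
    · rintro ⟨k, rfl⟩
      rcases Int.even_or_odd k with hk | hk
      · left; simp [hk.neg_one_zpow]
      · right; simp [hk.neg_one_zpow]
    · rintro (rfl | rfl)
      · exact H.one_mem
      · exact Subgroup.mem_zpowers _
  have hiff : ∀ X Y, (dosetSetoid (Gamma1' m p) A).r X Y ↔
      (lam X : (ZMod p)ˣ ⧸ H) = (lam Y : (ZMod p)ˣ ⧸ H) := by
    intro X Y
    rw [QuotientGroup.eq, hHmem]
    constructor
    · rintro ⟨γ, hγ, c, hc, h⟩
      have h1 : e ᵥ* (φ Y.1).val = (lam X : ZMod p) • (e ᵥ* (φ c).val) := by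
        rw [h, map_mul, map_mul, Units.val_mul, Units.val_mul, ← Matrix.vecMul_vecMul,
          ← Matrix.vecMul_vecMul, (memΓ γ).1 hγ, hlam X, Matrix.smul_vecMul]
      rw [hlam Y] at h1
      rcases hsign c hc with h2 | h2
      · left
        rw [h2] at h1
        have := Units.ext (heinj _ _ h1)
        rw [this, inv_mul_cancel]
      · right
        rw [h2, smul_neg, ← neg_smul] at h1
        have h3 : lam Y = - lam X := Units.ext (heinj _ _ h1)
        rw [h3, mul_neg, inv_mul_cancel]
    · have main : ∀ c : GL (Fin m) ℤ, ∀ Z : GL (Fin m) ℤ,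
          e ᵥ* (φ Z).val = e ᵥ* (φ (X.1 * c)).val → ∃ γ ∈ Gamma1' m p, Z = γ * X.1 * c := by
        intro c Z h
        refine ⟨Z * (X.1 * c)⁻¹, ?_, by group⟩
        rw [memΓ, map_mul, Units.val_mul, ← Matrix.vecMul_vecMul, h, Matrix.vecMul_vecMul,
          ← Units.val_mul, ← map_mul, mul_inv_cancel, map_one, Units.val_one, Matrix.vecMul_one]
      rintro (h | h)
      · have h1 : lam Y = lam X := by rw [inv_mul_eq_one] at h; exact h.symm
        obtain ⟨γ, hγ, h2⟩ := main 1 Y.1 (by rw [mul_one, hlam, hlam, h1])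
        exact ⟨γ, hγ, 1, Subgroup.one_mem _, h2⟩
      · have h1 : lam Y = - lam X := by
          rw [inv_mul_eq_iff_eq_mul] at h; rw [h]; simp
        have hneg : (φ (X.1 * -1)).val = - (φ X.1).val := by
          ext i j
          simp [hφ]
        obtain ⟨γ, hγ, h2⟩ := main (-1) Y.1 (by
          rw [hneg, Matrix.vecMul_neg, hlam, hlam, h1]; simp)
        refine ⟨γ, hγ, -1, ?_, h2⟩
        rw [Subgroup.mem_centralizer_iff]
        rintro _ rfl
        simp
  let F : Quotient (dosetSetoid (Gamma1' m p) A) → (ZMod p)ˣ ⧸ H :=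
    Quotient.lift (fun X => (lam X : (ZMod p)ˣ ⧸ H)) (fun X Y h => (hiff X Y).1 h)
  have hFb : Function.Bijective F := by
    constructor
    · intro x y
      induction x using Quotient.inductionOn
      induction y using Quotient.inductionOn
      intro h
      exact Quotient.sound ((hiff _ _).2 h)
    · intro y
      obtain ⟨u, rfl⟩ := QuotientGroup.mk_surjective y
      have hcop : IsCoprime (((u : ZMod p).val : ℕ) : ℤ) (p : ℤ) :=
        Nat.isCoprime_iff_coprime.2 (ZMod.val_coe_unit_coprime u)
      obtain ⟨X, hX⟩ := exists_lift (p := p) hm _ hcop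
      have hX' : e ᵥ* (φ X).val = (u : ZMod p) • e := by
        refine Eq.trans hX ?_
        simp [he]
      have hXN : X * A * X⁻¹ ∈ Gamma1' m p := by
        rw [memΓ, map_mul, map_mul, Units.val_mul, Units.val_mul, ← Matrix.vecMul_vecMul,
          ← Matrix.vecMul_vecMul, hX', Matrix.smul_vecMul, (memΓ A).1 hA, ← hX',
          Matrix.vecMul_vecMul, ← Units.val_mul, ← map_mul, mul_inv_cancel, map_one, Units.val_one,
          Matrix.vecMul_one]
      refine ⟨Quotient.mk _ ⟨X, hXN⟩, ?_⟩
      have : lam ⟨X, hXN⟩ = u := Units.ext (heinj _ _ ((hlam ⟨X, hXN⟩).symm.trans hX'))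
      change ((lam ⟨X, hXN⟩ : (ZMod p)ˣ) : (ZMod p)ˣ ⧸ H) = _
      rw [this]
  rw [Nat.card_eq_of_bijective F hFb]
  have hc := Subgroup.card_eq_card_quotient_mul_card_subgroup H
  have hcH : Nat.card H = 2 := by
    rw [hH, Nat.card_zpowers, ← orderOf_units, Units.coe_neg_one, orderOf_neg_one,
      ringChar.eq (ZMod p) p, if_neg (by omega)]
  have hcU : Nat.card (ZMod p)ˣ = p - 1 := by
    rw [Nat.card_eq_fintype_card, ZMod.card_units]
  rw [hcH, hcU] at hc
  omega
end

section
/- Let p ≥ 5 be a prime and n ≥ 0 an integer. Then χ_h(Γ_1(2,p), S^n) = ((1+(−1)^n)/4)·(p−1) − ((n+1)/24)·(p²−1), and χ_h(Γ_1(2,p), S^n ⊗ det) = −((1+(−1)^n)/4)·(p−1) − ((n+1)/24)·(p²−1). -/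
open Matrix

/-- The homological Euler characteristic `χ_h(G,V) = Σ (-1)^i dim H^i(G,V)` of a group `G`
with coefficients in a representation `ρ` of `G` on `W`. -/
noncomputable def chiH {G : Type} [Group G] {W : Type} [AddCommGroup W] [Module ℂ W]
    (ρ : Representation ℂ G W) : ℤ :=
  ∑ᶠ i : ℕ, (-1 : ℤ) ^ i * (Module.finrank ℂ (groupCohomology (Rep.of ρ) i) : ℤ)

section part1
open CategoryTheory Limits groupCohomology

theorem linEuler {A B C D : Type} [AddCommGroup A] [Module ℂ A] [AddCommGroup B] [Module ℂ B]
    [AddCommGroup C] [Module ℂ C] [AddCommGroup D] [Module ℂ D]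
    [FiniteDimensional ℂ B] [FiniteDimensional ℂ C]
    (i : A →ₗ[ℂ] B) (f : B →ₗ[ℂ] C) (d : C →ₗ[ℂ] D) (hi : Function.Injective i)
    (h1 : Function.Exact i f) (h2 : Function.Exact f d) (hd : Function.Surjective d) :
    (Module.finrank ℂ A : ℤ) - Module.finrank ℂ D = Module.finrank ℂ B - Module.finrank ℂ C := by
  have e1 : Module.finrank ℂ A = Module.finrank ℂ (LinearMap.ker f) := by
    rw [h1.linearMap_ker_eq, LinearMap.finrank_range_of_inj hi]
  have e2 := LinearMap.finrank_range_add_finrank_ker f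
  have e3 := LinearMap.finrank_range_add_finrank_ker d
  rw [h2.linearMap_ker_eq, LinearMap.range_eq_top.2 hd, finrank_top] at e3
  omega

theorem chiH_of_ses {G : Type} [Group G] (X : ShortComplex (Rep.{0} ℂ G)) (hX : X.ShortExact)
    (h2 : ∀ n, IsZero (groupCohomology X.X₂ (n+1))) (h3 : ∀ n, IsZero (groupCohomology X.X₃ (n+1)))
    [FiniteDimensional ℂ (groupCohomology X.X₂ 0)] [FiniteDimensional ℂ (groupCohomology X.X₃ 0)] :
    (∑ᶠ i : ℕ, (-1 : ℤ) ^ i * (Module.finrank ℂ (groupCohomology X.X₁ i) : ℤ)) =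
      Module.finrank ℂ (groupCohomology X.X₂ 0) - Module.finrank ℂ (groupCohomology X.X₃ 0) := by
  have hz : ∀ n, IsZero (groupCohomology X.X₁ (n+2)) := by
    intro n
    have := isIso_δ_of_isZero hX (n+1) (h2 n) (h2 (n+1))
    exact (h3 n).of_iso (asIso (δ hX (n+1) (n+2) rfl)).symm
  have hz' : ∀ n, Module.finrank ℂ (groupCohomology X.X₁ (n+2)) = 0 := by
    intro n
    have := ModuleCat.subsingleton_of_isZero (hz n)
    exact Module.finrank_zero_of_subsingleton
  rw [finsum_eq_sum_of_support_subset (s := {0, 1})]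
  · rw [Finset.sum_pair (by norm_num)]
    have hm : Mono X.f := hX.mono_f
    have key := linEuler (map (MonoidHom.id G) X.f 0).hom (map (MonoidHom.id G) X.g 0).hom (δ hX 0 1 rfl).hom
      ((ModuleCat.mono_iff_injective _).1 inferInstance)
      (by exact (ShortComplex.ShortExact.moduleCat_exact_iff_function_exact _).1 (mapShortComplex₂_exact hX 0))
      (by exact (ShortComplex.ShortExact.moduleCat_exact_iff_function_exact _).1 (mapShortComplex₃_exact hX (i := 0) rfl))
      ((ModuleCat.epi_iff_surjective _).1 (epi_δ_of_isZero hX 0 (h2 0)))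
    have e : (-1:ℤ)^0 * (Module.finrank ℂ (groupCohomology X.X₁ 0) : ℤ) + (-1:ℤ)^1 * (Module.finrank ℂ (groupCohomology X.X₁ 1) : ℤ)
       = Module.finrank ℂ (groupCohomology X.X₁ 0) - Module.finrank ℂ (groupCohomology X.X₁ 1) := by ring
    rw [e]
    exact key
  · intro i hi
    rcases i with _ | _ | n
    · simp
    · simp
    · simp [hz'] at hi

theorem fin_acyclic {D : Type} [Group D] [Finite D] (A : Rep.{0} ℂ D) (n : ℕ) :
    IsZero (groupCohomology A (n+1)) := by
  have : NeZero (Nat.card D : ℂ) := ⟨by exact_mod_cast Nat.card_pos.ne'⟩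
  exact (isZero_Ext_succ_of_projective (Rep.trivial ℂ D ℂ) A n).of_iso <| groupCohomologyIsoExt _ _

theorem coind_acyclic {G : Type} [Group G] (D : Subgroup G) [Finite D] (A : Rep.{0} ℂ D) (n : ℕ) :
    IsZero (groupCohomology (Rep.coind D.subtype A) (n+1)) :=
  (fin_acyclic A n).of_iso (coindIso A _)

noncomputable def coindH0 {G : Type} [Group G] (D : Subgroup G) (A : Rep.{0} ℂ D) :
    groupCohomology (Rep.coind D.subtype A) 0 ≃ₗ[ℂ] A.ρ.invariants :=
  (coindIso A 0 ≪≫ H0Iso A).toLinearEquiv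

theorem char_finrank {D W : Type} [Group D] [Fintype D] [AddCommGroup W] [Module ℂ W]
    [FiniteDimensional ℂ W] (ρ : Representation ℂ D W) :
    (Module.finrank ℂ ρ.invariants : ℂ) = (Fintype.card D : ℂ)⁻¹ * ∑ g : D, LinearMap.trace ℂ W (ρ g) := by
  have : Invertible (Nat.card D : ℂ) := invertibleOfNonzero (by exact_mod_cast Nat.card_pos.ne')
  rw [← ρ.card_inv_mul_sum_char_eq_finrank, Nat.card_eq_fintype_card]
  rfl

end part1

section part2
open CategoryTheory Limits groupCohomology

/-- Data of a tree-like configuration: vertex stabilizer `A`, edge stabilizer `B`, edge inversion `s`. -/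
structure TreeData (G : Type) [Group G] where
  A : Subgroup G
  B : Subgroup G
  s : G
  hss : s * s = 1
  hsA : s ∉ A
  hsB : s ∈ B
  χ : B →* ℂ
  hχ : ∀ b : B, (χ b = 1 ∧ (b : G) ∈ A ∧ s * b * s ∈ A) ∨ (χ b = -1 ∧ s * b ∈ A ∧ (b : G) * s ∈ A)
  gen : Subgroup.closure ((A : Set G) ∪ {s}) = ⊤
  ht : G → ℤ
  htB : ∀ x, ∀ b ∈ B, ht (x * b) = ht x
  good : G → Prop
  good_or : ∀ x, good x ∨ good (x * s)
  good_lt : ∀ x, good x → ∀ a ∈ A, a ∉ B → ht x < ht (x * a)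

namespace TreeData

variable {G : Type} [Group G] (T : TreeData G)

theorem exists_section : ∃ x : G ⧸ T.B → G, ∀ e, (x e : G ⧸ T.B) = e ∧ T.good (x e) := by
  have : ∀ e : G ⧸ T.B, ∃ x : G, (x : G ⧸ T.B) = e ∧ T.good x := by
    intro e
    induction e using QuotientGroup.induction_on with
    | H z =>
      rcases T.good_or z with h | h
      · exact ⟨z, rfl, h⟩
      · exact ⟨z * T.s, by rw [QuotientGroup.mk_mul_of_mem _ T.hsB], h⟩
  exact ⟨fun e => (this e).choose, fun e => (this e).choose_spec⟩

noncomputable def sec : G ⧸ T.B → G := T.exists_section.choose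
theorem sec_mk (e : G ⧸ T.B) : (T.sec e : G ⧸ T.B) = e := (T.exists_section.choose_spec e).1
theorem sec_good (e : G ⧸ T.B) : T.good (T.sec e) := (T.exists_section.choose_spec e).2

noncomputable def bd (e : G ⧸ T.B) : (G ⧸ T.A) →₀ ℂ :=
  Finsupp.single (T.sec e : G ⧸ T.A) 1 - Finsupp.single ((T.sec e * T.s : G) : G ⧸ T.A) 1

theorem eq_of_adj (e e' : G ⧸ T.B) (hle : T.ht (T.sec e') ≤ T.ht (T.sec e))
    (h : (T.sec e' : G ⧸ T.A) = T.sec e ∨ ((T.sec e' * T.s : G) : G ⧸ T.A) = T.sec e) : e' = e := by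
  obtain ⟨y, hyB, hyA⟩ : ∃ y : G, (y : G ⧸ T.B) = e' ∧ (y : G ⧸ T.A) = T.sec e := by
    rcases h with h | h
    · exact ⟨_, T.sec_mk e', h⟩
    · exact ⟨_, by rw [QuotientGroup.mk_mul_of_mem _ T.hsB, T.sec_mk], h⟩
  have ha : (T.sec e)⁻¹ * y ∈ T.A := QuotientGroup.eq.1 hyA.symm
  have hy : T.sec e * ((T.sec e)⁻¹ * y) = y := by group
  by_cases hb : (T.sec e)⁻¹ * y ∈ T.B
  · rw [← hyB, ← T.sec_mk e]
    exact (QuotientGroup.eq.2 hb).symm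
  · have := T.good_lt _ (T.sec_good e) _ ha hb
    rw [hy] at this
    have h2 : (T.sec e')⁻¹ * y ∈ T.B := QuotientGroup.eq.1 (by rw [T.sec_mk, hyB])
    have h3 := T.htB (T.sec e') _ h2
    rw [show T.sec e' * ((T.sec e')⁻¹ * y) = y by group] at h3
    omega

theorem bd_indep : LinearIndependent ℂ T.bd := by
  classical
  rw [linearIndependent_iff']
  intro S c hc
  by_contra hne
  push Not at hne
  obtain ⟨e0, he0, hce0⟩ := hne
  obtain ⟨e, he, hmax⟩ := Finset.exists_max_image (S.filter fun e => c e ≠ 0)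
    (fun e => T.ht (T.sec e)) ⟨e0, by simp [he0, hce0]⟩
  rw [Finset.mem_filter] at he
  have h := DFunLike.congr_fun hc (T.sec e : G ⧸ T.A)
  rw [Finsupp.finsetSum_apply, Finset.sum_eq_single e] at h
  · have hs : ¬ (((T.sec e * T.s : G) : G ⧸ T.A) = T.sec e) := by
      intro h'
      have := QuotientGroup.eq.1 h'.symm
      rw [inv_mul_cancel_left] at this
      exact T.hsA this
    simp [bd, Finsupp.single_apply, hs] at h
    exact he.2 h
  · intro e' he' hne
    by_cases hc' : c e' = 0
    · simp [hc']
    · have hle := hmax e' (by simp [he', hc'])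
      have h1 : ¬ (T.sec e' : G ⧸ T.A) = T.sec e := fun h => hne (T.eq_of_adj e e' hle (Or.inl h))
      have h2 : ¬ ((T.sec e' * T.s : G) : G ⧸ T.A) = T.sec e := fun h => hne (T.eq_of_adj e e' hle (Or.inr h))
      simp only [bd, Finsupp.smul_apply, Finsupp.sub_apply, Finsupp.single_apply, if_neg h1, if_neg h2]
      simp
  · intro h'; exact absurd he.1 h'

theorem exists_primitive {W : Type} [AddCommGroup W] [Module ℂ W] (H : G → W)
    (hH : ∀ x, ∀ b : T.B, H (x * b) = T.χ b • H x) :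
    ∃ F : G ⧸ T.A → W, ∀ x : G, F (x : G ⧸ T.A) - F ((x * T.s : G) : G ⧸ T.A) = H x := by
  obtain ⟨L, hL⟩ := LinearMap.exists_extend
    ((Module.Basis.span T.bd_indep).constr ℂ (fun e => H (T.sec e)))
  have hL' : ∀ e, L (T.bd e) = H (T.sec e) := by
    intro e
    have h1 := LinearMap.congr_fun hL (Module.Basis.span T.bd_indep e)
    rw [Module.Basis.constr_basis] at h1
    rw [← h1]
    simp [Module.Basis.span_apply]
  refine ⟨fun q => L (Finsupp.single q 1), fun x => ?_⟩
  have hb : (T.sec (x : G ⧸ T.B))⁻¹ * x ∈ T.B := QuotientGroup.eq.1 (T.sec_mk _)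
  have hx : T.sec (x : G ⧸ T.B) * ((T.sec (x : G ⧸ T.B))⁻¹ * x) = x := by group
  have hHx := hH (T.sec (x : G ⧸ T.B)) ⟨_, hb⟩
  have hc := T.hχ ⟨_, hb⟩
  have hLx := hL' (x : G ⧸ T.B)
  simp only at hHx hc
  rw [hx] at hHx
  rw [bd, map_sub] at hLx
  have hs' : T.s⁻¹ = T.s := inv_eq_of_mul_eq_one_left T.hss
  rcases hc with ⟨h1, h2, h3⟩ | ⟨h1, h2, h3⟩
  · rw [hHx, h1, one_smul, ← hLx]
    have e1 : (x : G ⧸ T.A) = T.sec (x : G ⧸ T.B) := (QuotientGroup.eq.2 h2).symm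
    have e2 : ((x * T.s : G) : G ⧸ T.A) = ((T.sec (x : G ⧸ T.B) * T.s : G) : G ⧸ T.A) := by
      refine (QuotientGroup.eq.2 ?_).symm
      rw [_root_.mul_inv_rev, hs']
      simpa [mul_assoc] using h3
    rw [e1, e2]
  · rw [hHx, h1, neg_one_smul, ← hLx]
    have e1 : ((x * T.s : G) : G ⧸ T.A) = T.sec (x : G ⧸ T.B) := by
      refine (QuotientGroup.eq.2 ?_).symm
      simpa [mul_assoc] using h3
    have e2 : (x : G ⧸ T.A) = ((T.sec (x : G ⧸ T.B) * T.s : G) : G ⧸ T.A) := by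
      refine (QuotientGroup.eq.2 ?_).symm
      rw [_root_.mul_inv_rev, hs']
      simpa [mul_assoc] using h2
    rw [e1, ← e2]
    simp

variable {W : Type} [AddCommGroup W] [Module ℂ W] (ρ : Representation ℂ G W)

/-- restriction to `A`. -/
abbrev ρA : Representation ℂ T.A W := ρ.comp T.A.subtype

/-- restriction to `B`, twisted. -/
def ρB : Representation ℂ T.B W where
  toFun b := T.χ b • ρ b
  map_one' := by simp
  map_mul' a b := by
    simp only [map_mul, Subgroup.coe_mul]
    rw [smul_mul_smul_comm]

theorem ρB_apply (b : T.B) (w : W) : T.ρB ρ b w = T.χ b • ρ b w := rfl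

def toI0 : ρ.IntertwiningMap (Representation.coind T.A.subtype (T.ρA ρ)) where
  toFun w := ⟨fun x => ρ x w, by
    rw [Representation.mem_coindV]; intro g h; simp⟩
  map_add' := by intros; ext; simp
  map_smul' := by intros; ext; simp
  isIntertwining' g := by
    refine LinearMap.ext fun w => Subtype.ext (funext fun x => ?_)
    change ρ x (ρ g w) = ρ (x * g) w
    simp

theorem ρss (w : W) : ρ T.s (ρ T.s w) = w := by
  rw [← Module.End.mul_apply, ← map_mul, T.hss]; simp

def toI1 : (Representation.coind T.A.subtype (T.ρA ρ)).IntertwiningMap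
    (Representation.coind T.B.subtype (T.ρB ρ)) where
  toFun f := ⟨fun x => f.1 x - ρ T.s (f.1 (T.s * x)), by
    rw [Representation.mem_coindV]
    intro b x
    have hf : ∀ a ∈ T.A, ∀ y, f.1 (a * y) = ρ a (f.1 y) := fun a ha y => f.2 ⟨a, ha⟩ y
    rw [ρB_apply]
    simp only [Subgroup.subtype_apply]
    rcases T.hχ b with ⟨h1, h2, h3⟩ | ⟨h1, h2, h3⟩
    · rw [h1, one_smul, hf _ h2, show T.s * ((b:G) * x) = (T.s * b * T.s) * (T.s * x) by
        rw [mul_assoc (T.s * (b : G)), ← mul_assoc T.s T.s x, T.hss]; group, hf _ h3]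
      simp [ρss]
    · rw [h1, neg_one_smul, ← mul_assoc, hf _ h2, show (b:G) * x = (b * T.s) * (T.s * x) by
        rw [mul_assoc (b : G), ← mul_assoc T.s T.s x, T.hss]; group, hf _ h3]
      simp [ρss]⟩
  map_add' := by intros; ext; simp; abel
  map_smul' := by intros; ext; simp [smul_sub]
  isIntertwining' g := by
    refine LinearMap.ext fun f => Subtype.ext (funext fun x => ?_)
    change f.1 (x * g) - ρ T.s (f.1 (T.s * x * g)) = f.1 (x * g) - ρ T.s (f.1 (T.s * (x * g)))
    rw [mul_assoc]

theorem toI0_apply (w : W) (x : G) : (T.toI0 ρ w).1 x = ρ x w := rfl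
theorem toI1_apply (f) (x : G) : (T.toI1 ρ f).1 x = f.1 x - ρ T.s (f.1 (T.s * x)) := rfl

theorem toI0_inj : Function.Injective (T.toI0 ρ) := by
  intro a b h
  have := congrArg (fun f => f.1 1) h
  simpa [toI0_apply] using this

theorem toI_comp (w : W) : T.toI1 ρ (T.toI0 ρ w) = 0 := by
  apply Subtype.ext
  funext x
  rw [toI1_apply, toI0_apply, toI0_apply]
  simp [ρss]

theorem toI_exact (f) (hf : T.toI1 ρ f = 0) : ∃ w, T.toI0 ρ w = f := by
  have hs : ∀ x, f.1 (T.s * x) = ρ T.s (f.1 x) := by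
    intro x
    have := congrArg (fun f => f.1 x) hf
    simp only [toI1_apply] at this
    rw [sub_eq_zero.1 this, ρss]
  have key : ∀ g : G, ∀ x, f.1 (g * x) = ρ g (f.1 x) := by
    intro g
    have hg : g ∈ Subgroup.closure ((T.A : Set G) ∪ {T.s}) := by rw [T.gen]; trivial
    induction hg using Subgroup.closure_induction with
    | mem y hy =>
      intro x
      rcases hy with hy | hy
      · exact f.2 ⟨y, hy⟩ x
      · rw [Set.mem_singleton_iff] at hy; rw [hy]; exact hs x
    | one => intro x; simp
    | mul a b _ _ ha hb => intro x; rw [mul_assoc, ha, hb]; simp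
    | inv a _ ha =>
      intro x
      have := ha (a⁻¹ * x)
      rw [mul_inv_cancel_left] at this
      rw [this]; simp
  refine ⟨f.1 1, ?_⟩
  apply Subtype.ext
  funext x
  rw [toI0_apply, ← key, mul_one]

theorem toI1_surj : Function.Surjective (T.toI1 ρ) := by
  intro h
  have hs' : T.s⁻¹ = T.s := inv_eq_of_mul_eq_one_left T.hss
  obtain ⟨F, hF⟩ := T.exists_primitive (fun x => ρ x (h.1 x⁻¹)) (by
    intro x b
    have h1 := h.2 b ((b : G)⁻¹ * x⁻¹)
    rw [Subgroup.subtype_apply, mul_inv_cancel_left, ρB_apply] at h1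
    have hχ : T.χ b • T.χ b • (h.1 ((b : G)⁻¹ * x⁻¹)) = h.1 ((b : G)⁻¹ * x⁻¹) := by
      rcases T.hχ b with h | h <;> simp [h.1]
    simp only [_root_.mul_inv_rev]
    rw [h1, map_smul]
    simp only [map_mul, Module.End.mul_apply]
    rw [← map_smul, ← map_smul, ← map_smul, ← map_smul, hχ])
  refine ⟨⟨fun x => ρ x (F ((x⁻¹ : G) : G ⧸ T.A)), ?_⟩, ?_⟩
  · rw [Representation.mem_coindV]
    intro a x
    have : (((a * x : G)⁻¹ : G) : G ⧸ T.A) = ((x⁻¹ : G) : G ⧸ T.A) := by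
      rw [_root_.mul_inv_rev, QuotientGroup.mk_mul_of_mem _ (T.A.inv_mem a.2)]
    simp [this]
  · apply Subtype.ext
    funext x
    rw [toI1_apply]
    have := hF x⁻¹
    simp only [_root_.mul_inv_rev, hs', map_mul, Module.End.mul_apply, ρss]
    rw [← map_sub, this]
    simp

noncomputable def ses : ShortComplex (Rep.{0} ℂ G) :=
  ShortComplex.mk (X₁ := Rep.of ρ) (X₂ := Rep.coind T.A.subtype (Rep.of (T.ρA ρ)))
    (X₃ := Rep.coind T.B.subtype (Rep.of (T.ρB ρ)))
    (Rep.ofHom (T.toI0 ρ)) (Rep.ofHom (T.toI1 ρ)) (by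
      apply Rep.hom_ext
      ext1
      exact LinearMap.ext fun w => T.toI_comp ρ w)

theorem ses_exact : (T.ses ρ).ShortExact where
  exact := by
    rw [← ShortComplex.exact_map_iff_of_faithful _ (forget₂ (Rep.{0} ℂ G) (ModuleCat.{0} ℂ))]
    rw [ShortComplex.ShortExact.moduleCat_exact_iff_function_exact]
    intro f
    constructor
    · intro hf; exact T.toI_exact ρ f hf
    · rintro ⟨w, rfl⟩; exact T.toI_comp ρ w
  mono_f := (Rep.mono_iff_injective _).2 (T.toI0_inj ρ)
  epi_g := (Rep.epi_iff_surjective _).2 (T.toI1_surj ρ)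

theorem chi [Finite T.A] [Finite T.B] [FiniteDimensional ℂ W] :
    chiH ρ = Module.finrank ℂ (T.ρA ρ).invariants - Module.finrank ℂ (T.ρB ρ).invariants := by
  let eA := coindH0 T.A (Rep.of (T.ρA ρ))
  let eB := coindH0 T.B (Rep.of (T.ρB ρ))
  have : FiniteDimensional ℂ (groupCohomology (T.ses ρ).X₂ 0) :=
    Module.Finite.equiv (M := (T.ρA ρ).invariants) eA.symm
  have : FiniteDimensional ℂ (groupCohomology (T.ses ρ).X₃ 0) :=
    Module.Finite.equiv (M := (T.ρB ρ).invariants) eB.symm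
  have h := chiH_of_ses (T.ses ρ) (T.ses_exact ρ) (coind_acyclic T.A _) (coind_acyclic T.B _)
  refine h.trans ?_
  congr 2
  · exact eA.finrank_eq
  · exact eB.finrank_eq

end TreeData

end part2

section part3
abbrev GZ := GL (Fin 2) ℤ

def ent (g : GZ) : ℤ × ℤ × ℤ × ℤ := (g.1 0 0, g.1 0 1, g.1 1 0, g.1 1 1)

theorem ent_inj : Function.Injective ent := by
  intro g h e
  simp only [ent, Prod.mk.injEq] at e
  apply Units.ext
  ext i j
  fin_cases i <;> fin_cases j <;> simp [e.1, e.2.1, e.2.2.1, e.2.2.2]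

theorem gz_det (g : GZ) : g.1 0 0 * g.1 1 1 - g.1 0 1 * g.1 1 0 = 1 ∨ g.1 0 0 * g.1 1 1 - g.1 0 1 * g.1 1 0 = -1 := by
  have h : IsUnit g.1.det := (Matrix.isUnit_iff_isUnit_det _).1 g.isUnit
  rw [Matrix.det_fin_two] at h
  exact Int.isUnit_iff.1 h

theorem mul00 (g h : GZ) : (g * h).1 0 0 = g.1 0 0 * h.1 0 0 + g.1 0 1 * h.1 1 0 := by
  simp [Matrix.mul_apply, Fin.sum_univ_two]
theorem mul01 (g h : GZ) : (g * h).1 0 1 = g.1 0 0 * h.1 0 1 + g.1 0 1 * h.1 1 1 := by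
  simp [Matrix.mul_apply, Fin.sum_univ_two]
theorem mul10 (g h : GZ) : (g * h).1 1 0 = g.1 1 0 * h.1 0 0 + g.1 1 1 * h.1 1 0 := by
  simp [Matrix.mul_apply, Fin.sum_univ_two]
theorem mul11 (g h : GZ) : (g * h).1 1 1 = g.1 1 0 * h.1 0 1 + g.1 1 1 * h.1 1 1 := by
  simp [Matrix.mul_apply, Fin.sum_univ_two]

/-- Orthogonal group of an integral form. -/
def orth (Q : Matrix (Fin 2) (Fin 2) ℤ) : Subgroup GZ where
  carrier := {g | g.1ᵀ * Q * g.1 = Q}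
  one_mem' := by simp
  mul_mem' := by
    intro a b ha hb
    change (a.1 * b.1)ᵀ * Q * (a.1 * b.1) = Q
    change a.1ᵀ * Q * a.1 = Q at ha
    change b.1ᵀ * Q * b.1 = Q at hb
    calc (a.1 * b.1)ᵀ * Q * (a.1 * b.1) = b.1ᵀ * (a.1ᵀ * Q * a.1) * b.1 := by
          rw [Matrix.transpose_mul]; simp only [Matrix.mul_assoc]
      _ = Q := by rw [ha, hb]
  inv_mem' := by
    intro a ha
    change (a⁻¹).1ᵀ * Q * (a⁻¹).1 = Q
    change a.1ᵀ * Q * a.1 = Q at ha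
    have h1 : a.1 * (a⁻¹).1 = 1 := by rw [← Units.val_mul]; simp
    calc (a⁻¹).1ᵀ * Q * (a⁻¹).1 = (a⁻¹).1ᵀ * (a.1ᵀ * Q * a.1) * (a⁻¹).1 := by rw [ha]
      _ = (a.1 * (a⁻¹).1)ᵀ * Q * (a.1 * (a⁻¹).1) := by
          rw [Matrix.transpose_mul]; simp only [Matrix.mul_assoc]
      _ = Q := by rw [h1]; simp

def GA : Subgroup GZ := orth !![2, -1; -1, 2]
def GB : Subgroup GZ := orth 1

def LA : Finset (ℤ × ℤ × ℤ × ℤ) :=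
  {(1,0,0,1), (-1,0,0,-1), (0,1,1,0), (0,-1,-1,0), (1,-1,1,0), (-1,1,-1,0), (0,-1,1,-1), (0,1,-1,1),
   (1,-1,0,-1), (-1,1,0,1), (1,0,1,-1), (-1,0,-1,1)}

def LB : Finset (ℤ × ℤ × ℤ × ℤ) :=
  {(1,0,0,1), (-1,0,0,-1), (0,1,1,0), (0,-1,-1,0), (1,0,0,-1), (-1,0,0,1), (0,1,-1,0), (0,-1,1,0)}

theorem memA_iff (g : GZ) : g ∈ GA ↔ (g.1 0 0 ^2 - g.1 0 0 * g.1 1 0 + g.1 1 0 ^2 = 1 ∧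
    g.1 0 1 ^2 - g.1 0 1 * g.1 1 1 + g.1 1 1 ^2 = 1 ∧
    2 * g.1 0 0 * g.1 0 1 - g.1 0 0 * g.1 1 1 - g.1 0 1 * g.1 1 0 + 2 * g.1 1 0 * g.1 1 1 = -1) := by
  change g.1ᵀ * _ * g.1 = _ ↔ _
  rw [← Matrix.ext_iff]
  simp only [Fin.forall_fin_two, Matrix.mul_apply, Fin.sum_univ_two, Matrix.transpose_apply]
  simp
  constructor
  · rintro ⟨⟨h1, h2⟩, h3, h4⟩
    refine ⟨by linarith, by linarith, by linarith⟩
  · rintro ⟨h1, h2, h3⟩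
    refine ⟨⟨by linarith, by linarith⟩, by linarith, by linarith⟩

theorem memB_iff (g : GZ) : g ∈ GB ↔ (g.1 0 0 ^2 + g.1 1 0 ^2 = 1 ∧
    g.1 0 1 ^2 + g.1 1 1 ^2 = 1 ∧
    g.1 0 0 * g.1 0 1 + g.1 1 0 * g.1 1 1 = 0) := by
  change g.1ᵀ * _ * g.1 = _ ↔ _
  rw [← Matrix.ext_iff]
  simp only [Fin.forall_fin_two, Matrix.mul_apply, Fin.sum_univ_two, Matrix.transpose_apply]
  simp
  constructor
  · rintro ⟨⟨h1, h2⟩, h3, h4⟩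
    refine ⟨by linarith, by linarith, by linarith⟩
  · rintro ⟨h1, h2, h3⟩
    refine ⟨⟨by linarith, by linarith⟩, by linarith, by linarith⟩

theorem memA_ent (g : GZ) : g ∈ GA ↔ ent g ∈ LA := by
  rw [memA_iff]
  unfold ent
  generalize g.1 0 0 = a
  generalize g.1 0 1 = b
  generalize g.1 1 0 = c
  generalize g.1 1 1 = d
  constructor
  · rintro ⟨h1, h2, h3⟩
    have : -1 ≤ a := by nlinarith [sq_nonneg (a - 2*c)]
    have : a ≤ 1 := by nlinarith [sq_nonneg (a - 2*c)]
    have : -1 ≤ c := by nlinarith [sq_nonneg (2*a - c)]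
    have : c ≤ 1 := by nlinarith [sq_nonneg (2*a - c)]
    have : -1 ≤ b := by nlinarith [sq_nonneg (b - 2*d)]
    have : b ≤ 1 := by nlinarith [sq_nonneg (b - 2*d)]
    have : -1 ≤ d := by nlinarith [sq_nonneg (2*b - d)]
    have : d ≤ 1 := by nlinarith [sq_nonneg (2*b - d)]
    interval_cases a <;> interval_cases c <;> first | (exfalso; omega) | skip
    all_goals interval_cases b <;> interval_cases d <;> first | (exfalso; omega) | decide
  · intro h
    simp only [LA, Finset.mem_insert, Finset.mem_singleton, Prod.mk.injEq] at h
    rcases h with h | h | h | h | h | h | h | h | h | h | h | h <;>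
      (obtain ⟨rfl, rfl, rfl, rfl⟩ := h; norm_num)

theorem memB_ent (g : GZ) : g ∈ GB ↔ ent g ∈ LB := by
  rw [memB_iff]
  unfold ent
  generalize g.1 0 0 = a
  generalize g.1 0 1 = b
  generalize g.1 1 0 = c
  generalize g.1 1 1 = d
  constructor
  · rintro ⟨h1, h2, h3⟩
    have : -1 ≤ a := by nlinarith
    have : a ≤ 1 := by nlinarith
    have : -1 ≤ c := by nlinarith
    have : c ≤ 1 := by nlinarith
    have : -1 ≤ b := by nlinarith
    have : b ≤ 1 := by nlinarith
    have : -1 ≤ d := by nlinarith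
    have : d ≤ 1 := by nlinarith
    interval_cases a <;> interval_cases c <;> first | (exfalso; omega) | skip
    all_goals interval_cases b <;> interval_cases d <;> first | (exfalso; omega) | decide
  · intro h
    simp only [LB, Finset.mem_insert, Finset.mem_singleton, Prod.mk.injEq] at h
    rcases h with h | h | h | h | h | h | h | h <;>
      (obtain ⟨rfl, rfl, rfl, rfl⟩ := h; norm_num)

theorem casesA {g : GZ} (h : g ∈ GA) (P : ℤ → ℤ → ℤ → ℤ → Prop)
    (hP : ∀ q ∈ LA, P q.1 q.2.1 q.2.2.1 q.2.2.2) : P (g.1 0 0) (g.1 0 1) (g.1 1 0) (g.1 1 1) :=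
  hP _ ((memA_ent g).1 h)

theorem casesB {g : GZ} (h : g ∈ GB) (P : ℤ → ℤ → ℤ → ℤ → Prop)
    (hP : ∀ q ∈ LB, P q.1 q.2.1 q.2.2.1 q.2.2.2) : P (g.1 0 0) (g.1 0 1) (g.1 1 0) (g.1 1 1) :=
  hP _ ((memB_ent g).1 h)

def gs : GZ := ⟨!![1, 0; 0, -1], !![1, 0; 0, -1], by decide, by decide⟩
def gt : GZ := ⟨!![0, 1; 1, 0], !![0, 1; 1, 0], by decide, by decide⟩
def gu : GZ := ⟨!![1, -1; 0, -1], !![1, -1; 0, -1], by decide, by decide⟩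

theorem gs00 : gs.1 0 0 = 1 := rfl
theorem gs01 : gs.1 0 1 = 0 := rfl
theorem gs10 : gs.1 1 0 = 0 := rfl
theorem gs11 : gs.1 1 1 = -1 := rfl

def permHom : GB →* ℂ where
  toFun b := ((b.1.1 0 0 * b.1.1 1 1 + b.1.1 0 1 * b.1.1 1 0 : ℤ) : ℂ)
  map_one' := by simp
  map_mul' x y := by
    rw [← Int.cast_mul]
    congr 1
    simp only [Subgroup.coe_mul, mul00, mul01, mul10, mul11]
    have hx := (memB_ent x.1).1 x.2
    have hy := (memB_ent y.1).1 y.2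
    simp only [LB, ent, Finset.mem_insert, Finset.mem_singleton, Prod.mk.injEq] at hx hy
    rcases hx with h | h | h | h | h | h | h | h <;> simp only [h] <;>
    rcases hy with h | h | h | h | h | h | h | h <;> simp only [h] <;> norm_num

theorem gen_aux : Subgroup.closure ((GA : Set GZ) ∪ {gs}) = ⊤ := by
  set K := Subgroup.closure ((GA : Set GZ) ∪ {gs}) with hK
  have hs : gs ∈ K := Subgroup.subset_closure (Or.inr rfl)
  have hA : ∀ g ∈ GA, g ∈ K := fun g hg => Subgroup.subset_closure (Or.inl hg)
  have ht : gt ∈ K := hA _ ((memA_ent _).2 (by decide))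
  have hu : gu ∈ K := hA _ ((memA_ent _).2 (by decide))
  have hSL : ∀ x : SpecialLinearGroup (Fin 2) ℤ, (x : GZ) ∈ K := by
    intro x
    have hx : x ∈ Subgroup.closure {ModularGroup.S, ModularGroup.T} := by
      rw [SpecialLinearGroup.SL2Z_generators]; trivial
    induction hx using Subgroup.closure_induction with
    | mem y hy =>
      rcases hy with hy | hy
      · have : (y : GZ) = gt * gs := by
          rw [hy]; apply ent_inj; rfl
        rw [this]; exact K.mul_mem ht hs
      · have : (y : GZ) = gu * gs := by
          rw [Set.mem_singleton_iff.1 hy]; apply ent_inj; rfl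
        rw [this]; exact K.mul_mem hu hs
    | one => simpa using K.one_mem
    | mul a b _ _ ha hb => simpa using K.mul_mem ha hb
    | inv a _ ha => simpa using K.inv_mem ha
  have hdet : ∀ g : GZ, g.1 0 0 * g.1 1 1 - g.1 0 1 * g.1 1 0 = 1 → g ∈ K := by
    intro g hg
    have := hSL ⟨g.1, by rw [Matrix.det_fin_two]; exact hg⟩
    convert this using 1
    apply Units.ext; rfl
  rw [eq_top_iff]
  intro g _
  rcases gz_det g with h | h
  · exact hdet g h
  · have h2 : gs * g ∈ K := by
      apply hdet
      simp only [mul00, mul01, mul10, mul11, gs00, gs01, gs10, gs11]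
      linarith
    have := K.mul_mem (K.inv_mem hs) h2
    rwa [inv_mul_cancel_left] at this

theorem col_pos (x : GZ) : 0 < x.1 0 0 ^ 2 + x.1 1 0 ^ 2 ∧ 0 < x.1 0 1 ^ 2 + x.1 1 1 ^ 2 := by
  have hd := gz_det x
  constructor
  · by_contra h
    have h0 : x.1 0 0 = 0 := by nlinarith [sq_nonneg (x.1 0 0), sq_nonneg (x.1 1 0)]
    have h1 : x.1 1 0 = 0 := by nlinarith [sq_nonneg (x.1 0 0), sq_nonneg (x.1 1 0)]
    rw [h0, h1] at hd; simp at hd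
  · by_contra h
    have h0 : x.1 0 1 = 0 := by nlinarith [sq_nonneg (x.1 0 1), sq_nonneg (x.1 1 1)]
    have h1 : x.1 1 1 = 0 := by nlinarith [sq_nonneg (x.1 0 1), sq_nonneg (x.1 1 1)]
    rw [h0, h1] at hd; simp at hd

def gzTree : TreeData GZ where
  A := GA
  B := GB
  s := gs
  hss := by apply ent_inj; rfl
  hsA := by rw [memA_ent]; decide
  hsB := by rw [memB_ent]; decide
  χ := permHom
  hχ b := by
    have hb := (memB_ent b.1).1 b.2
    simp only [memA_iff, mul00, mul01, mul10, mul11, gs00, gs01, gs10, gs11]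
    simp only [permHom, MonoidHom.coe_mk, OneHom.coe_mk]
    simp only [LB, ent, Finset.mem_insert, Finset.mem_singleton, Prod.mk.injEq] at hb
    rcases hb with h | h | h | h | h | h | h | h <;> simp only [h] <;> norm_num
  gen := gen_aux
  ht x := x.1 0 0 ^ 2 + x.1 1 0 ^ 2 + (x.1 0 1 ^ 2 + x.1 1 1 ^ 2)
  htB x b hb := by
    have hb := (memB_ent b).1 hb
    simp only [mul00, mul01, mul10, mul11]
    simp only [LB, ent, Finset.mem_insert, Finset.mem_singleton, Prod.mk.injEq] at hb
    rcases hb with h | h | h | h | h | h | h | h <;> simp only [h] <;> ring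
  good x := 0 ≤ x.1 0 0 * x.1 0 1 + x.1 1 0 * x.1 1 1
  good_or x := by
    simp only [mul00, mul01, mul10, mul11, gs00, gs01, gs10, gs11]
    rcases le_total 0 (x.1 0 0 * x.1 0 1 + x.1 1 0 * x.1 1 1) with h | h
    · left; exact h
    · right; linarith
  good_lt x hx a ha hb := by
    have ha := (memA_ent a).1 ha
    rw [memB_iff] at hb
    obtain ⟨hu, hv⟩ := col_pos x
    simp only [mul00, mul01, mul10, mul11]
    simp only [LA, ent, Finset.mem_insert, Finset.mem_singleton, Prod.mk.injEq] at ha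
    rcases ha with h | h | h | h | h | h | h | h | h | h | h | h <;> simp only [h] at hb ⊢ <;>
     first | (exfalso; norm_num at hb; done) | nlinarith

/-- enumeration of a finite subgroup -/
theorem enum (D : Subgroup GZ) (L : Finset (ℤ × ℤ × ℤ × ℤ)) (hD : ∀ g : GZ, g ∈ D ↔ ent g ∈ L)
    (hL : ∀ q ∈ L, q.1 * q.2.2.2 - q.2.1 * q.2.2.1 = 1 ∨ q.1 * q.2.2.2 - q.2.1 * q.2.2.1 = -1) :
    ∃ e : D ≃ L, ∀ g : D, (e g : ℤ × ℤ × ℤ × ℤ) = ent g.1 := by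
  refine ⟨Equiv.ofBijective (fun g => ⟨ent g.1, (hD _).1 g.2⟩) ⟨?_, ?_⟩, fun g => rfl⟩
  · intro g h e
    exact Subtype.ext (ent_inj (Subtype.ext_iff.1 e))
  · rintro ⟨⟨a, b, c, d⟩, hq⟩
    have h := hL _ hq
    let g : GZ := Matrix.GeneralLinearGroup.mk'' !![a, b; c, d] (by
      rw [Matrix.det_fin_two_of]; exact Int.isUnit_iff.2 h)
    have hg : ent g = (a, b, c, d) := rfl
    exact ⟨⟨g, (hD g).2 (hg ▸ hq)⟩, Subtype.ext hg⟩

theorem enumA : ∃ e : GA ≃ LA, ∀ g : GA, (e g : ℤ × ℤ × ℤ × ℤ) = ent g.1 :=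
  enum GA LA memA_ent (by decide)
theorem enumB : ∃ e : GB ≃ LB, ∀ g : GB, (e g : ℤ × ℤ × ℤ × ℤ) = ent g.1 :=
  enum GB LB memB_ent (by decide)

instance : Finite GA := enumA.elim fun e _ => Finite.of_equiv _ e.symm
instance : Finite GB := enumB.elim fun e _ => Finite.of_equiv _ e.symm
instance : Finite gzTree.A := inferInstanceAs (Finite GA)
instance : Finite gzTree.B := inferInstanceAs (Finite GB)

end part3

section part4
open Matrix CategoryTheory groupCohomology

section omega
variable (p : ℕ)

abbrev Om := {w : Fin 2 → ZMod p // w ≠ 0}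

def gmod (g : GZ) : GL (Fin 2) (ZMod p) := Matrix.GeneralLinearGroup.map (Int.castRingHom (ZMod p)) g

theorem gmod_apply (g : GZ) (i j) : (gmod p g).1 i j = ((g.1 i j : ℤ) : ZMod p) := rfl

theorem gmod_mul (g h : GZ) : gmod p (g * h) = gmod p g * gmod p h := map_mul _ _ _
theorem gmod_one : gmod p 1 = 1 := map_one _

def omAct (g : GZ) (w : Om p) : Om p := ⟨w.1 ᵥ* (gmod p g).1, by
  intro h
  apply w.2
  have : w.1 ᵥ* (gmod p g).1 ᵥ* ((gmod p g)⁻¹).1 = w.1 := by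
    rw [Matrix.vecMul_vecMul, ← Units.val_mul]; simp
  rw [← this, h]; simp⟩

theorem omAct_one (w : Om p) : omAct p 1 w = w := by
  apply Subtype.ext; simp [omAct, gmod_one]

theorem omAct_mul (g h : GZ) (w : Om p) : omAct p (g * h) w = omAct p h (omAct p g w) := by
  apply Subtype.ext; simp [omAct, gmod_mul]

theorem omAct_0 (g : GZ) (w : Om p) : (omAct p g w).1 0 = w.1 0 * ((g.1 0 0 : ℤ) : ZMod p) + w.1 1 * ((g.1 1 0 : ℤ) : ZMod p) := by
  simp [omAct, Matrix.vecMul, dotProduct, Fin.sum_univ_two, gmod_apply]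
theorem omAct_1 (g : GZ) (w : Om p) : (omAct p g w).1 1 = w.1 0 * ((g.1 0 1 : ℤ) : ZMod p) + w.1 1 * ((g.1 1 1 : ℤ) : ZMod p) := by
  simp [omAct, Matrix.vecMul, dotProduct, Fin.sum_univ_two, gmod_apply]

theorem om_ext {v w : Om p} (h0 : v.1 0 = w.1 0) (h1 : v.1 1 = w.1 1) : v = w := by
  apply Subtype.ext; funext i; fin_cases i
  · exact h0
  · exact h1

theorem om_ne (w : Om p) : ¬ (w.1 0 = 0 ∧ w.1 1 = 0) := by
  rintro ⟨h0, h1⟩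
  apply w.2; funext i; fin_cases i
  · exact h0
  · exact h1

variable [hp : Fact p.Prime]

def om0 : Om p := ⟨stdLast 2 p, by
  intro h
  have := congrFun h 1
  simp [stdLast] at this⟩

theorem om0_0 : (om0 p).1 0 = 0 := by simp [om0, stdLast]
theorem om0_1 : (om0 p).1 1 = 1 := by simp [om0, stdLast]

theorem mem_gamma (g : GZ) : g ∈ Gamma1' 2 p ↔ omAct p g (om0 p) = om0 p := by
  rw [Subtype.ext_iff]; exact Iff.rfl

theorem om_trans (w : Om p) : ∃ g : GZ, omAct p g (om0 p) = w := by
  suffices h : ∃ a b c d : ℤ, a * d - b * c = 1 ∧ (c : ZMod p) = w.1 0 ∧ (d : ZMod p) = w.1 1 by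
    obtain ⟨a, b, c, d, h, hc, hd⟩ := h
    refine ⟨Matrix.GeneralLinearGroup.mk'' !![a, b; c, d] (by
      rw [Matrix.det_fin_two_of]; exact Int.isUnit_iff.2 (Or.inl h)), ?_⟩
    apply om_ext
    · rw [omAct_0, om0_0, om0_1, ← hc]; simp
    · rw [omAct_1, om0_0, om0_1, ← hd]; simp
  obtain ⟨c, hc⟩ := ZMod.intCast_surjective (w.1 0)
  obtain ⟨d, hd⟩ := ZMod.intCast_surjective (w.1 1)
  have hpp : Prime (p : ℤ) := Nat.prime_iff_prime_int.1 hp.out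
  have cop : ∀ z : ℤ, (z : ZMod p) ≠ 0 → IsCoprime z (p : ℤ) := by
    intro z hz
    refine ((Irreducible.coprime_iff_not_dvd hpp.irreducible).2 ?_).symm
    rwa [← ZMod.intCast_zmod_eq_zero_iff_dvd z p] 
  by_cases h0 : w.1 0 = 0
  · have h1 : w.1 1 ≠ 0 := fun h1 => om_ne p w ⟨h0, h1⟩
    obtain ⟨v, u, huv⟩ := cop d (by rw [hd]; exact h1)
    exact ⟨v, -u, p, d, by linarith, by simp [h0], hd⟩
  · obtain ⟨u, v, huv⟩ := cop c (by rw [hc]; exact h0)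
    refine ⟨1, -((1 - d) * u), c, d * (u * c) + v * p, by linear_combination huv, hc, ?_⟩
    have : ((u * c : ℤ) : ZMod p) = 1 := by
      have := congrArg (Int.cast : ℤ → ZMod p) huv
      simpa using this
    rw [Int.cast_add, Int.cast_mul, this]
    simp [hd]

section rep
variable {V : Type} [AddCommGroup V] [Module ℂ V] (ρ : Representation ℂ GZ V)

def omRep : Representation ℂ GZ (Om p → V) where
  toFun g := (ρ g).compLeft (Om p) ∘ₗ LinearMap.funLeft ℂ V (omAct p g)
  map_one' := by
    refine LinearMap.ext fun φ => funext fun w => ?_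
    simp [LinearMap.funLeft, omAct_one]
  map_mul' g h := by
    refine LinearMap.ext fun φ => funext fun w => ?_
    simp [LinearMap.funLeft, omAct_mul]

theorem omRep_apply (g : GZ) (φ : Om p → V) (w : Om p) : omRep p ρ g φ w = ρ g (φ (omAct p g w)) := rfl

def omToCoind : (omRep p ρ).IntertwiningMap
    (Representation.coind (Gamma1' 2 p).subtype (ρ.comp (Gamma1' 2 p).subtype)) where
  toFun φ := ⟨fun g => ρ g (φ (omAct p g (om0 p))), by
    rw [Representation.mem_coindV]
    intro γ g
    have hγ := (mem_gamma p γ.1).1 γ.2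
    simp [omAct_mul, hγ]⟩
  map_add' := by intros; ext; simp
  map_smul' := by intros; ext; simp
  isIntertwining' h := by
    refine LinearMap.ext fun φ => Subtype.ext (funext fun g => ?_)
    change ρ g (ρ h (φ (omAct p h (omAct p g (om0 p))))) = ρ (g * h) (φ (omAct p (g * h) (om0 p)))
    simp [omAct_mul]

theorem omToCoind_apply (φ) (g : GZ) : (omToCoind p ρ φ).1 g = ρ g (φ (omAct p g (om0 p))) := rfl

theorem omToCoind_bij : Function.Bijective (omToCoind p ρ) := by
  constructor
  · intro φ ψ h
    funext w
    obtain ⟨g, rfl⟩ := om_trans p w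
    have := congrArg (fun f => ρ g⁻¹ (f.1 g)) h
    simpa [omToCoind_apply] using this
  · intro f
    choose s hs using om_trans p
    refine ⟨fun w => ρ (s w)⁻¹ (f.1 (s w)), ?_⟩
    apply Subtype.ext
    funext g
    rw [omToCoind_apply]
    set w := omAct p g (om0 p) with hw
    have hγ : g * (s w)⁻¹ ∈ Gamma1' 2 p := by
      rw [mem_gamma, omAct_mul, ← hw]
      calc omAct p (s w)⁻¹ w = omAct p (s w)⁻¹ (omAct p (s w) (om0 p)) := by rw [hs]
        _ = om0 p := by rw [← omAct_mul, mul_inv_cancel, omAct_one]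
    have := f.2 ⟨_, hγ⟩ (s w)
    simp at this
    rw [this]

theorem chi_shapiro : chiH (ρ.comp (Gamma1' 2 p).subtype) = chiH (omRep p ρ) := by
  unfold chiH
  have h1 : IsIso (Rep.ofHom (omToCoind p ρ)) := by
    have hm : Mono (Rep.ofHom (omToCoind p ρ)) := (Rep.mono_iff_injective _).2 (omToCoind_bij p ρ).1
    have he : Epi (Rep.ofHom (omToCoind p ρ)) := (Rep.epi_iff_surjective _).2 (omToCoind_bij p ρ).2
    exact isIso_of_mono_of_epi _
  apply finsum_congr
  intro i
  let e := (functor ℂ GZ i).mapIso (asIso (Rep.ofHom (omToCoind p ρ))) ≪≫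
    coindIso (Rep.of (ρ.comp (Gamma1' 2 p).subtype)) i
  congr 2
  exact e.toLinearEquiv.finrank_eq.symm

theorem omRep_trace [FiniteDimensional ℂ V] (g : GZ) :
    LinearMap.trace ℂ _ (omRep p ρ g) = (Nat.card {w : Om p // omAct p g w = w} : ℂ) * LinearMap.trace ℂ V (ρ g) := by
  classical
  let b := Module.finBasis ℂ V
  rw [LinearMap.trace_eq_matrix_trace ℂ (Pi.basis fun _ : Om p => b), LinearMap.trace_eq_matrix_trace ℂ b]
  simp only [Matrix.trace, Matrix.diag_apply, LinearMap.toMatrix_apply, Fintype.sum_sigma]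
  rw [Nat.card_eq_fintype_card, Fintype.card_subtype, Finset.card_filter]
  rw [Nat.cast_sum, Finset.sum_mul]
  refine Finset.sum_congr rfl fun w _ => ?_
  rw [Finset.mul_sum]
  refine Finset.sum_congr rfl fun i _ => ?_
  simp only [Pi.basis_repr, Pi.basis_apply, omRep_apply]
  by_cases h : omAct p g w = w
  · simp [h]
  · simp [h]

end rep
end omega

end part4

section part5
section counts
variable (p : ℕ) [hp : Fact p.Prime]

theorem card_om : (Nat.card (Om p) : ℂ) = (p : ℂ) ^ 2 - 1 := by
  classical
  have h : Fintype.card (Om p) = p ^ 2 - 1 := by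
    have := Fintype.card_subtype_compl (fun w : Fin 2 → ZMod p => w = 0)
    simp only [Fintype.card_subtype_eq] at this
    rw [Fintype.card_fun, ZMod.card, Fintype.card_fin] at this
    exact this
  rw [Nat.card_eq_fintype_card, h, Nat.cast_sub (Nat.one_le_pow _ _ hp.out.pos)]
  simp

theorem card_ne : (Nat.card {x : ZMod p // x ≠ 0} : ℂ) = (p : ℂ) - 1 := by
  classical
  have h : Fintype.card {x : ZMod p // x ≠ 0} = p - 1 := by
    have := Fintype.card_subtype_compl (fun w : ZMod p => w = 0)
    simp only [Fintype.card_subtype_eq] at this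
    rw [ZMod.card] at this
    exact this
  rw [Nat.card_eq_fintype_card, h, Nat.cast_sub hp.out.one_le]
  simp

theorem small_ne (hp5 : 5 ≤ p) (k : ℕ) (h0 : 0 < k) (h5 : k < 5) : ((k : ℕ) : ZMod p) ≠ 0 := by
  rw [Ne, ZMod.natCast_eq_zero_iff]
  intro h
  exact absurd (Nat.le_of_dvd h0 h) (by omega)

theorem fix_iff (g : GZ) (w : Om p) : omAct p g w = w ↔
    (w.1 0 * ((g.1 0 0 : ℤ) : ZMod p) + w.1 1 * ((g.1 1 0 : ℤ) : ZMod p) = w.1 0 ∧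
     w.1 0 * ((g.1 0 1 : ℤ) : ZMod p) + w.1 1 * ((g.1 1 1 : ℤ) : ZMod p) = w.1 1) := by
  constructor
  · intro h
    rw [← omAct_0, ← omAct_1, h]; exact ⟨rfl, rfl⟩
  · rintro ⟨h0, h1⟩
    exact om_ext p ((omAct_0 p g w).trans h0) ((omAct_1 p g w).trans h1)

theorem fix_one : (Nat.card {w : Om p // omAct p 1 w = w} : ℂ) = (p : ℂ) ^ 2 - 1 := by
  rw [← card_om]
  congr 1
  exact Nat.card_congr (Equiv.subtypeUnivEquiv (omAct_one p))

theorem fix_rot (hp5 : 5 ≤ p) (g : GZ) (hd : g.1 0 0 * g.1 1 1 - g.1 0 1 * g.1 1 0 = 1)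
    (k : ℕ) (h0 : 0 < k) (h5 : k < 5) (ht : g.1 0 0 + g.1 1 1 = 2 - k) :
    (Nat.card {w : Om p // omAct p g w = w} : ℂ) = 0 := by
  have hk := small_ne p hp5 k h0 h5
  have : IsEmpty {w : Om p // omAct p g w = w} := by
    constructor
    rintro ⟨w, hw⟩
    rw [fix_iff] at hw
    obtain ⟨e0, e1⟩ := hw
    have hd' := congrArg (Int.cast : ℤ → ZMod p) hd
    have ht' := congrArg (Int.cast : ℤ → ZMod p) ht
    push_cast at hd' ht'
    generalize ((g.1 0 0 : ℤ) : ZMod p) = a at *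
    generalize ((g.1 0 1 : ℤ) : ZMod p) = b at *
    generalize ((g.1 1 0 : ℤ) : ZMod p) = c at *
    generalize ((g.1 1 1 : ℤ) : ZMod p) = d at *
    apply om_ne p w
    constructor
    · have : (k : ZMod p) * w.1 0 = 0 := by
        linear_combination (d - 1) * e0 - c * e1 - w.1 0 * hd' + w.1 0 * ht'
      exact (mul_eq_zero.1 this).resolve_left hk
    · have : (k : ZMod p) * w.1 1 = 0 := by
        linear_combination (a - 1) * e1 - b * e0 - w.1 1 * hd' + w.1 1 * ht'
      exact (mul_eq_zero.1 this).resolve_left hk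
  simp

theorem fix_refl (hp5 : 5 ≤ p) (g : GZ) (hd : g.1 0 0 * g.1 1 1 - g.1 0 1 * g.1 1 0 = -1)
    (ht : g.1 0 0 + g.1 1 1 = 0) (ha : g.1 0 0 = -1 ∨ g.1 0 0 = 0 ∨ g.1 0 0 = 1) :
    (Nat.card {w : Om p // omAct p g w = w} : ℂ) = (p : ℂ) - 1 := by
  have h2 : (2 : ZMod p) ≠ 0 := by exact_mod_cast small_ne p hp5 2 (by norm_num) (by norm_num)
  have hd' := congrArg (Int.cast : ℤ → ZMod p) hd
  have ht' := congrArg (Int.cast : ℤ → ZMod p) ht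
  push_cast at hd' ht'
  have hfix := fix_iff p g
  rw [← card_ne]
  congr 1
  have ha' : (1 + ((g.1 0 0 : ℤ) : ZMod p) ≠ 0) ∨ (1 - ((g.1 0 0 : ℤ) : ZMod p) ≠ 0) := by
    rcases ha with h | h | h <;> rw [h] <;> norm_num <;> exact h2
  generalize ((g.1 0 0 : ℤ) : ZMod p) = a at *
  generalize ((g.1 0 1 : ℤ) : ZMod p) = b at *
  generalize ((g.1 1 0 : ℤ) : ZMod p) = c at *
  generalize ((g.1 1 1 : ℤ) : ZMod p) = d at *
  obtain rfl : d = -a := by linear_combination ht'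
  rcases ha' with h | h
  · refine Nat.card_congr (Equiv.ofBijective (fun w => ⟨w.1.1 0, ?_⟩) ⟨?_, ?_⟩)
    · intro h0
      have := (hfix w.1).1 w.2
      apply om_ne p w.1
      refine ⟨h0, ?_⟩
      have h3 : (1 + a) * w.1.1 1 = 0 := by linear_combination - this.2 + b * h0
      exact (mul_eq_zero.1 h3).resolve_left h
    · intro w v hwv
      have hwv : w.1.1 0 = v.1.1 0 := Subtype.ext_iff.1 hwv
      have e1 := ((hfix w.1).1 w.2).2
      have e2 := ((hfix v.1).1 v.2).2
      apply Subtype.ext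
      apply om_ext p hwv
      apply mul_left_cancel₀ h
      linear_combination b * hwv - e1 + e2
    · rintro ⟨x, hx⟩
      refine ⟨⟨⟨![x, b * x / (1 + a)], fun h0 => hx (by simpa using congrFun h0 0)⟩, ?_⟩, rfl⟩
      rw [hfix]
      simp only [Matrix.cons_val_zero, Matrix.cons_val_one]
      constructor
      · field_simp
        linear_combination (-1 : ZMod p) * hd'
      · field_simp
        ring
  · refine Nat.card_congr (Equiv.ofBijective (fun w => ⟨w.1.1 1, ?_⟩) ⟨?_, ?_⟩)
    · intro h0
      have := (hfix w.1).1 w.2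
      apply om_ne p w.1
      refine ⟨?_, h0⟩
      have h3 : (1 - a) * w.1.1 0 = 0 := by linear_combination - this.1 + c * h0
      exact (mul_eq_zero.1 h3).resolve_left h
    · intro w v hwv
      have hwv : w.1.1 1 = v.1.1 1 := Subtype.ext_iff.1 hwv
      have e1 := ((hfix w.1).1 w.2).1
      have e2 := ((hfix v.1).1 v.2).1
      apply Subtype.ext
      refine om_ext p ?_ hwv
      apply mul_left_cancel₀ h
      linear_combination c * hwv - e1 + e2
    · rintro ⟨x, hx⟩
      refine ⟨⟨⟨![c * x / (1 - a), x], fun h0 => hx (by simpa using congrFun h0 1)⟩, ?_⟩, rfl⟩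
      rw [hfix]
      simp only [Matrix.cons_val_zero, Matrix.cons_val_one]
      constructor
      · field_simp
        ring
      · field_simp
        linear_combination (-1 : ZMod p) * hd'

variable {V : Type} [AddCommGroup V] [Module ℂ V] [FiniteDimensional ℂ V] (ρ : Representation ℂ GZ V)

/-- value of the trace on a matrix from the lists -/
noncomputable def psi (T1 T2 : ℂ) (q : ℤ × ℤ × ℤ × ℤ) : ℂ :=
  if q = (1, 0, 0, 1) then T1 else if q.1 * q.2.2.2 - q.2.1 * q.2.2.1 = -1 then T2 else 0

theorem list_class : ∀ q ∈ LA ∪ LB, q = (1, 0, 0, 1) ∨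
    (q.1 * q.2.2.2 - q.2.1 * q.2.2.1 = -1 ∧ q.1 + q.2.2.2 = 0 ∧ (q.1 = -1 ∨ q.1 = 0 ∨ q.1 = 1)) ∨
    (q.1 * q.2.2.2 - q.2.1 * q.2.2.1 = 1 ∧
      (q.1 + q.2.2.2 = 1 ∨ q.1 + q.2.2.2 = 0 ∨ q.1 + q.2.2.2 = -1 ∨ q.1 + q.2.2.2 = -2)) := by
  decide

theorem trace_psi (hp5 : 5 ≤ p) (τ : ℂ)
    (hτ : ∀ g : GZ, g.1 0 0 * g.1 1 1 - g.1 0 1 * g.1 1 0 = -1 → g.1 0 0 + g.1 1 1 = 0 →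
      LinearMap.trace ℂ V (ρ g) = τ) (g : GZ) (hg : ent g ∈ LA ∪ LB) :
    LinearMap.trace ℂ _ (omRep p ρ g) =
      psi (((p : ℂ) ^ 2 - 1) * Module.finrank ℂ V) (((p : ℂ) - 1) * τ) (ent g) := by
  rw [omRep_trace]
  rcases list_class _ hg with h | ⟨h1, h2, h3⟩ | ⟨h1, h2⟩
  · have : g = 1 := ent_inj (h.trans rfl)
    subst this
    rw [fix_one, h, map_one, LinearMap.trace_one]
    simp [psi]
  · have hne : ent g ≠ (1, 0, 0, 1) := by
      intro h; rw [h] at h1; norm_num at h1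
    rw [psi, if_neg hne, if_pos h1]
    simp only [ent] at h1 h2 h3
    rw [fix_refl p hp5 g h1 h2 h3, hτ g h1 h2]
  · have hne : ent g ≠ (1, 0, 0, 1) := by
      intro h; rw [h] at h2; norm_num at h2
    have hne' : ¬ ((ent g).1 * (ent g).2.2.2 - (ent g).2.1 * (ent g).2.2.1 = -1) := by
      rw [h1]; norm_num
    rw [psi, if_neg hne, if_neg hne']
    simp only [ent] at h1 h2
    have : ∃ k : ℕ, 0 < k ∧ k < 5 ∧ g.1 0 0 + g.1 1 1 = 2 - k := by
      rcases h2 with h | h | h | h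
      · exact ⟨1, by norm_num, by norm_num, by rw [h]; norm_num⟩
      · exact ⟨2, by norm_num, by norm_num, by rw [h]; norm_num⟩
      · exact ⟨3, by norm_num, by norm_num, by rw [h]; norm_num⟩
      · exact ⟨4, by norm_num, by norm_num, by rw [h]; norm_num⟩
    obtain ⟨k, k0, k5, hk⟩ := this
    rw [fix_rot p hp5 g h1 k k0 k5 hk, zero_mul]

theorem main_chi (hp5 : 5 ≤ p) (τ : ℂ)
    (hτ : ∀ g : GZ, g.1 0 0 * g.1 1 1 - g.1 0 1 * g.1 1 0 = -1 → g.1 0 0 + g.1 1 1 = 0 →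
      LinearMap.trace ℂ V (ρ g) = τ) :
    (chiH (ρ.comp (Gamma1' 2 p).subtype) : ℂ) =
      ((p : ℂ) - 1) * τ / 2 - ((p : ℂ) ^ 2 - 1) * Module.finrank ℂ V / 24 := by
  classical
  rw [chi_shapiro, gzTree.chi]
  have fA : Fintype gzTree.A := Fintype.ofFinite _
  have fB : Fintype gzTree.B := Fintype.ofFinite _
  push_cast
  rw [char_finrank, char_finrank]
  obtain ⟨eA, hA⟩ := enumA
  obtain ⟨eB, hB⟩ := enumB
  have cA : Fintype.card gzTree.A = 12 := by
    have := Fintype.card_congr (show gzTree.A ≃ LA from eA)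
    rw [this, Fintype.card_coe]; rfl
  have cB : Fintype.card gzTree.B = 8 := by
    have := Fintype.card_congr (show gzTree.B ≃ LB from eB)
    rw [this, Fintype.card_coe]; rfl
  rw [cA, cB]
  set T1 := ((p : ℂ) ^ 2 - 1) * Module.finrank ℂ V with hT1
  set T2 := ((p : ℂ) - 1) * τ with hT2
  have sA : ∑ g : gzTree.A, LinearMap.trace ℂ _ (gzTree.ρA (omRep p ρ) g) = T1 + 6 * T2 := by
    have : ∀ g : gzTree.A, LinearMap.trace ℂ _ (gzTree.ρA (omRep p ρ) g) =
        psi T1 T2 ((show gzTree.A ≃ LA from eA) g).1 := by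
      intro g
      refine (trace_psi p ρ hp5 τ hτ g.1 (Finset.mem_union_left _ ((memA_ent _).1 g.2))).trans ?_
      exact congrArg _ (hA g).symm
    rw [Finset.sum_congr rfl fun g _ => this g]
    rw [Equiv.sum_comp (show gzTree.A ≃ LA from eA) (fun q => psi T1 T2 q.1)]
    rw [Finset.sum_coe_sort LA (fun q => psi T1 T2 q)]
    simp [LA, psi]
    ring
  have sB : ∑ g : gzTree.B, LinearMap.trace ℂ _ (gzTree.ρB (omRep p ρ) g) = T1 := by
    have : ∀ g : gzTree.B, LinearMap.trace ℂ _ (gzTree.ρB (omRep p ρ) g) =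
        (fun q : ℤ × ℤ × ℤ × ℤ => ((q.1 * q.2.2.2 + q.2.1 * q.2.2.1 : ℤ) : ℂ) * psi T1 T2 q)
          ((show gzTree.B ≃ LB from eB) g).1 := by
      intro g
      have h1 := (trace_psi p ρ hp5 τ hτ g.1 (Finset.mem_union_right _ ((memB_ent _).1 g.2)))
      have h2 : ((show gzTree.B ≃ LB from eB) g).1 = ent g.1 := hB g
      rw [h2]
      have h3 : gzTree.ρB (omRep p ρ) g = gzTree.χ g • omRep p ρ g := rfl
      rw [h3, map_smul, h1]
      rfl
    rw [Finset.sum_congr rfl fun g _ => this g]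
    rw [Equiv.sum_comp (show gzTree.B ≃ LB from eB) (fun q => (fun q : ℤ × ℤ × ℤ × ℤ => ((q.1 * q.2.2.2 + q.2.1 * q.2.2.1 : ℤ) : ℂ) * psi T1 T2 q) q.1)]
    rw [Finset.sum_coe_sort LB (fun q : ℤ × ℤ × ℤ × ℤ => ((q.1 * q.2.2.2 + q.2.1 * q.2.2.1 : ℤ) : ℂ) * psi T1 T2 q)]
    simp [LB, psi]
  rw [sA, sB]
  push_cast
  ring

end counts

end part5

section part6
section symm
open MvPolynomial
variable (n : ℕ)

abbrev Hn := MvPolynomial.homogeneousSubmodule (Fin 2) ℂ n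

noncomputable def subst (m : Matrix (Fin 2) (Fin 2) ℂ) : MvPolynomial (Fin 2) ℂ →ₐ[ℂ] MvPolynomial (Fin 2) ℂ :=
  MvPolynomial.aeval (fun j => ∑ i, m i j • MvPolynomial.X i)

theorem subst_hom (m : Matrix (Fin 2) (Fin 2) ℂ) (f : MvPolynomial (Fin 2) ℂ)
    (hf : f ∈ Hn n) : subst m f ∈ Hn n := by
  rw [mem_homogeneousSubmodule] at *
  have := hf.aeval (fun j => ∑ i, m i j • (MvPolynomial.X i : MvPolynomial (Fin 2) ℂ)) (n := 1) (by
    intro j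
    rw [← mem_homogeneousSubmodule]
    exact Submodule.sum_mem _ fun i _ => Submodule.smul_mem _ _ (isHomogeneous_X _ _))
  rwa [one_mul] at this

noncomputable def symM (m : Matrix (Fin 2) (Fin 2) ℂ) : Hn n →ₗ[ℂ] Hn n :=
  (subst m).toLinearMap.restrict (subst_hom n m)

theorem symM_coe (m) (f : Hn n) : (symM n m f : MvPolynomial (Fin 2) ℂ) = subst m f := rfl

theorem subst_mul (m m' : Matrix (Fin 2) (Fin 2) ℂ) : subst (m * m') = (subst m).comp (subst m') := by
  apply MvPolynomial.algHom_ext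
  intro j
  simp only [subst, AlgHom.comp_apply, aeval_X, Matrix.mul_apply, Fin.sum_univ_two]
  rw [map_add, map_smul, map_smul, aeval_X, aeval_X]
  module

theorem symM_mul (m m') : symM n (m * m') = symM n m * symM n m' := by
  apply LinearMap.ext; intro f
  apply Subtype.ext
  simp only [Module.End.mul_apply, symM_coe, subst_mul, AlgHom.comp_apply]

theorem symM_one : symM n 1 = 1 := by
  apply LinearMap.ext; intro f
  apply Subtype.ext
  have : subst 1 = AlgHom.id ℂ _ := by
    apply MvPolynomial.algHom_ext
    intro j
    fin_cases j <;> simp [subst, Matrix.one_apply]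
  simp [symM_coe, this]

abbrev Idx := {d : Fin 2 →₀ ℕ | d.degree = n}

noncomputable def hbasis : Module.Basis (Idx n) ℂ (Hn n) :=
  (basisRestrictSupport ℂ {d : Fin 2 →₀ ℕ | d.degree = n}).map
    (LinearEquiv.ofEq _ _ (homogeneousSubmodule_eq_finsupp_supported (Fin 2) ℂ n).symm)

theorem hbasis_coe (d : Idx n) : (hbasis n d : MvPolynomial (Fin 2) ℂ) = monomial d.1 1 := by
  have h : (hbasis n d : MvPolynomial (Fin 2) ℂ) =
    (basisRestrictSupport ℂ {d : Fin 2 →₀ ℕ | d.degree = n} d : MvPolynomial (Fin 2) ℂ) := rfl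
  rw [h]
  have hm : (monomial d.1 (1 : ℂ)) ∈ restrictSupport ℂ {d : Fin 2 →₀ ℕ | d.degree = n} := by
    have h2 := (homogeneousSubmodule_eq_finsupp_supported (Fin 2) ℂ n)
    have h3 : monomial d.1 (1 : ℂ) ∈ homogeneousSubmodule (Fin 2) ℂ n := isHomogeneous_monomial _ d.2
    rw [h2] at h3
    exact h3
  have : basisRestrictSupport ℂ {d : Fin 2 →₀ ℕ | d.degree = n} d = ⟨monomial d.1 1, hm⟩ := by
    apply (basisRestrictSupport ℂ {d : Fin 2 →₀ ℕ | d.degree = n}).repr.injective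
    rw [Module.Basis.repr_self]
    ext e
    have h4 : (basisRestrictSupport ℂ {d : Fin 2 →₀ ℕ | d.degree = n}).repr ⟨monomial d.1 1, hm⟩ e =
      coeff e.1 (monomial d.1 (1 : ℂ)) := rfl
    rw [h4, coeff_monomial, Finsupp.single_apply]
    simp only [Subtype.ext_iff]
  rw [this]

noncomputable def idxEquiv : Idx n ≃ Fin (n + 1) where
  toFun d := ⟨d.1 1, by
    have h : d.1.degree = n := d.2
    rw [Finsupp.degree_eq_sum, Fin.sum_univ_two] at h
    omega⟩
  invFun k := ⟨Finsupp.single 0 (n - k) + Finsupp.single 1 k.1, by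
    simp only [Set.mem_ofPred_eq, Finsupp.degree_eq_sum, Fin.sum_univ_two]
    simp
    omega⟩
  left_inv d := by
    apply Subtype.ext
    have h : d.1.degree = n := d.2
    rw [Finsupp.degree_eq_sum, Fin.sum_univ_two] at h
    ext i
    fin_cases i
    · simp; omega
    · simp
  right_inv k := by
    apply Fin.ext
    simp

noncomputable instance : Fintype (Idx n) := Fintype.ofEquiv _ (idxEquiv n).symm

instance : FiniteDimensional ℂ (Hn n) := (hbasis n).finiteDimensional_of_finite

theorem hn_finrank : Module.finrank ℂ (Hn n) = n + 1 := by
  rw [Module.finrank_eq_card_basis (hbasis n), Fintype.card_congr (idxEquiv n), Fintype.card_fin]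

theorem symM_basis (d : Idx n) : symM n !![1, 0; 0, -1] (hbasis n d) = (-1 : ℂ) ^ (d.1 1) • hbasis n d := by
  apply Subtype.ext
  rw [symM_coe, Submodule.coe_smul, hbasis_coe]
  simp only [subst, aeval_monomial, map_one, one_mul]
  rw [Finsupp.prod_fintype _ _ (by simp), Fin.prod_univ_two]
  rw [monomial_eq, Finsupp.prod_fintype _ _ (by simp), Fin.prod_univ_two]
  simp [neg_pow (X 1 : MvPolynomial (Fin 2) ℂ)]
  rw [MvPolynomial.smul_eq_C_mul]
  simp
  ring

theorem alt_sum : ∑ k ∈ Finset.range (n + 1), (-1 : ℂ) ^ k = (1 + (-1) ^ n) / 2 := by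
  induction n with
  | zero => simp
  | succ n ih => rw [Finset.sum_range_succ, ih]; ring

theorem trace_s : LinearMap.trace ℂ (Hn n) (symM n !![1, 0; 0, -1]) = (1 + (-1) ^ n) / 2 := by
  classical
  rw [LinearMap.trace_eq_matrix_trace ℂ (hbasis n)]
  simp only [Matrix.trace, Matrix.diag_apply, LinearMap.toMatrix_apply, symM_basis]
  simp only [map_smul, Module.Basis.repr_self, Finsupp.smul_apply, Finsupp.single_eq_same, smul_eq_mul, mul_one]
  rw [← alt_sum, ← Fin.sum_univ_eq_sum_range (fun k => (-1 : ℂ) ^ k)]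
  exact Equiv.sum_comp (idxEquiv n) (fun k => (-1 : ℂ) ^ k.1)

theorem trace_conj_sym (m P : Matrix (Fin 2) (Fin 2) ℂ) (hP : P.det ≠ 0)
    (h : m * P = P * !![1, 0; 0, -1]) :
    LinearMap.trace ℂ (Hn n) (symM n m) = (1 + (-1) ^ n) / 2 := by
  have hu : IsUnit P.det := isUnit_iff_ne_zero.2 hP
  have hm : m = P * (!![1, 0; 0, -1] * P⁻¹) := by
    rw [← Matrix.mul_assoc, ← h, Matrix.mul_assoc, Matrix.mul_nonsing_inv _ hu, Matrix.mul_one]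
  rw [hm, symM_mul, LinearMap.trace_mul_comm, ← symM_mul, Matrix.mul_assoc, Matrix.nonsing_inv_mul _ hu,
    Matrix.mul_one, trace_s]

theorem mk2 {a b c d a' b' c' d' : ℂ} (h1 : a = a') (h2 : b = b') (h3 : c = c') (h4 : d = d') :
    !![a, b; c, d] = !![a', b'; c', d'] := by
  rw [h1, h2, h3, h4]

theorem trace_refl (m : Matrix (Fin 2) (Fin 2) ℂ) (hd : m 0 0 * m 1 1 - m 0 1 * m 1 0 = -1)
    (ht : m 0 0 + m 1 1 = 0) : LinearMap.trace ℂ (Hn n) (symM n m) = (1 + (-1) ^ n) / 2 := by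
  obtain ⟨a, b, c, d, rfl⟩ : ∃ a b c d, m = !![a, b; c, d] := ⟨_, _, _, _, Matrix.eta_fin_two m⟩
  simp at hd ht
  obtain rfl : d = -a := by linear_combination ht
  by_cases h : a = -1
  · subst h
    refine trace_conj_sym n _ !![b, 1 - (-1); 1 - (-1), -c] ?_ ?_
    · rw [Matrix.det_fin_two_of]
      intro h0
      have : (4 : ℂ) = 0 := by linear_combination -h0 + hd
      norm_num at this
    · rw [Matrix.mul_fin_two, Matrix.mul_fin_two]
      apply mk2
      · ring
      · linear_combination hd
      · linear_combination -hd
      · ring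
  · refine trace_conj_sym n _ !![1 + a, -b; c, 1 + a] ?_ ?_
    · rw [Matrix.det_fin_two_of]
      intro h0
      have : (2 : ℂ) * (1 + a) = 0 := by linear_combination h0 + hd
      apply h
      have h1 := (mul_eq_zero.1 this).resolve_left (by norm_num)
      linear_combination h1
    · rw [Matrix.mul_fin_two, Matrix.mul_fin_two]
      apply mk2
      · linear_combination -hd
      · ring
      · ring
      · linear_combination hd

end symm

section final

theorem final_aux (p : ℕ) (hp : p.Prime) (hp5 : 5 ≤ p) (n : ℕ) (σ : ℂ)
    (ρ : Representation ℂ GZ (Hn n))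
    (hτ : ∀ g : GZ, g.1 0 0 * g.1 1 1 - g.1 0 1 * g.1 1 0 = -1 → g.1 0 0 + g.1 1 1 = 0 →
      LinearMap.trace ℂ (Hn n) (ρ g) = σ * ((1 + (-1) ^ n) / 2)) :
    (chiH (ρ.comp (Gamma1' 2 p).subtype) : ℂ) =
      σ * ((1 + (-1 : ℂ) ^ n) / 4) * ((p : ℂ) - 1) - (((n : ℂ) + 1) / 24) * ((p : ℂ) ^ 2 - 1) := by
  have : Fact p.Prime := ⟨hp⟩
  rw [main_chi p ρ hp5 _ hτ, hn_finrank]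
  push_cast
  ring

end final

end part6

/-- For a prime `p ≥ 5` and `n ≥ 0`:
`χ_h(Γ₁(2,p), Sⁿ) = ((1+(−1)ⁿ)/4)(p−1) − ((n+1)/24)(p²−1)` and
`χ_h(Γ₁(2,p), Sⁿ ⊗ det) = −((1+(−1)ⁿ)/4)(p−1) − ((n+1)/24)(p²−1)`, where `Sⁿ` is the n-th
symmetric power of the standard representation of `GL 2 ℤ`, realized on the space of
homogeneous polynomials of degree `n` in two variables (the variable `X j` transforming to
`∑ i, g i j • X i`). -/
theorem stmt6 (p : ℕ) (hp : p.Prime) (hp5 : 5 ≤ p) (n : ℕ)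
    (ρ ρdet : Representation ℂ (GL (Fin 2) ℤ)
      (MvPolynomial.homogeneousSubmodule (Fin 2) ℂ n))
    (hρ : ∀ (g : GL (Fin 2) ℤ) (f : MvPolynomial.homogeneousSubmodule (Fin 2) ℂ n),
      (ρ g f : MvPolynomial (Fin 2) ℂ) =
        MvPolynomial.aeval
          (fun j => ∑ i, (((g : Matrix (Fin 2) (Fin 2) ℤ) i j : ℤ) : ℂ) • MvPolynomial.X i)
          (f : MvPolynomial (Fin 2) ℂ))
    (hρdet : ∀ (g : GL (Fin 2) ℤ) (f : MvPolynomial.homogeneousSubmodule (Fin 2) ℂ n),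
      ρdet g f = (((g : Matrix (Fin 2) (Fin 2) ℤ).det : ℤ) : ℂ) • ρ g f) :
    (chiH (ρ.comp (Gamma1' 2 p).subtype) : ℚ)
        = ((1 + (-1 : ℚ) ^ n) / 4) * ((p : ℚ) - 1) - (((n : ℚ) + 1) / 24) * ((p : ℚ) ^ 2 - 1)
    ∧ (chiH (ρdet.comp (Gamma1' 2 p).subtype) : ℚ)
        = -((1 + (-1 : ℚ) ^ n) / 4) * ((p : ℚ) - 1)
          - (((n : ℚ) + 1) / 24) * ((p : ℚ) ^ 2 - 1) := by
  have htr : ∀ g : GZ, g.1 0 0 * g.1 1 1 - g.1 0 1 * g.1 1 0 = -1 → g.1 0 0 + g.1 1 1 = 0 →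
      LinearMap.trace ℂ (Hn n) (ρ g) = (1 + (-1) ^ n) / 2 := by
    intro g h1 h2
    have : ρ g = symM n (g.1.map (Int.cast : ℤ → ℂ)) := by
      apply LinearMap.ext
      intro f
      apply Subtype.ext
      rw [hρ, symM_coe]
      rfl
    rw [this]
    apply trace_refl
    · simp only [Matrix.map_apply]
      exact_mod_cast congrArg (Int.cast : ℤ → ℂ) h1
    · simp only [Matrix.map_apply]
      exact_mod_cast congrArg (Int.cast : ℤ → ℂ) h2
  have hdet : ∀ g : GZ, g.1 0 0 * g.1 1 1 - g.1 0 1 * g.1 1 0 = -1 → g.1 0 0 + g.1 1 1 = 0 →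
      LinearMap.trace ℂ (Hn n) (ρdet g) = (-1) * ((1 + (-1) ^ n) / 2) := by
    intro g h1 h2
    have : ρdet g = (-1 : ℂ) • ρ g := by
      apply LinearMap.ext
      intro f
      rw [hρdet, Matrix.det_fin_two, h1, Int.cast_neg, Int.cast_one]
      rfl
    rw [this, map_smul, htr g h1 h2, smul_eq_mul]
  have e1 := final_aux p hp hp5 n 1 ρ (fun g h1 h2 => by rw [htr g h1 h2, one_mul])
  have e2 := final_aux p hp hp5 n (-1) ρdet hdet
  constructor
  · apply (Rat.cast_injective (α := ℂ))
    push_cast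
    rw [e1]
    ring
  · apply (Rat.cast_injective (α := ℂ))
    push_cast
    rw [e2]
    ring
end
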